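/- arXiv:1707.07730 — 3 statements merged into one kernel-verified Lean document; each statement's English description precedes it below -/
import Mathlib

section
/- Let φ be the substitution on {0,1} with φ(0) = 1, φ(1) = 100, u_n = φ^n(1), v_0 = 00, v_n = u_{n−1}u_{n−1} for n ≥ 1, and l_n = max(|u_n|, |v_n|). For every n ∈ ℕ, the Lyndon system associated to the alternate Lyndon word u_n \overline{v_n} has topological entropy log γ_n > 0, where γ_n > 1 is the real number satisfying γ_n^{l_n} = γ_n + 1. -/
open Filter Topology

/-- Alternate (Ito–Sadahiro) strict order on infinite sequences (0-indexed: entry `i`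
is the `(i+1)`-th letter `x_{i+1}` of the paper). `altLt x y` iff at the first index
where they differ the comparison alternates with the parity of the index:
`(-1)^k (x_k - y_k) < 0` in 1-based indexing. -/
def altLt (x y : ℕ → ℕ) : Prop :=
  ∃ k : ℕ, (∀ i < k, x i = y i) ∧ (if Even k then y k < x k else x k < y k)

def altLe (x y : ℕ → ℕ) : Prop := x = y ∨ altLt x y

def shiftSeq (x : ℕ → ℕ) (k : ℕ) : ℕ → ℕ := fun i => x (k + i)

/-- An alternate Lyndon word: smaller (in the alternate order) than all of its shifts. -/
def IsAltLyndon (d : ℕ → ℕ) : Prop := ∀ k : ℕ, altLe d (shiftSeq d k)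

/-- The Lyndon system associated to `d`: sequences over the alphabet `{0, …, d_1}`
all of whose shifts dominate `d` in the alternate order. -/
def LyndonSystem (d : ℕ → ℕ) : Set (ℕ → ℕ) :=
  {x | (∀ i, x i ≤ d 0) ∧ ∀ k : ℕ, altLe d (shiftSeq x k)}

def IsFactorOf (w : List ℕ) (x : ℕ → ℕ) : Prop :=
  ∃ k : ℕ, w = (List.range w.length).map (fun i => x (k + i))

/-- The language of the Lyndon system: finite factors of its elements. -/
def LyndonLang (d : ℕ → ℕ) : Set (List ℕ) :=
  {w | ∃ x ∈ LyndonSystem d, IsFactorOf w x}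

/-- `Hword d n` is the number of words of length `n` in the language `L_M`. -/
noncomputable def Hword (d : ℕ → ℕ) (n : ℕ) : ℕ :=
  Set.ncard {w : List ℕ | w ∈ LyndonLang d ∧ w.length = n}

/-- The topological entropy of the Lyndon system of `d` equals `h`,
i.e. `lim_{n→∞} (log H_n)/n = h`. -/
def EntropyIs (d : ℕ → ℕ) (h : ℝ) : Prop :=
  Filter.Tendsto (fun n : ℕ => Real.log (Hword d n) / n) Filter.atTop (nhds h)

/-- The substitution `φ` on letters: `φ(0) = 1`, `φ(1) = 100`. -/
def phiL (a : ℕ) : List ℕ := if a = 0 then [1] else [1, 0, 0]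
/-- `φ` extended to words. -/
def phiW (w : List ℕ) : List ℕ := w.flatMap phiL
/-- `uW n = φ^n(1)`. -/
def uW (n : ℕ) : List ℕ := phiW^[n] [1]
/-- The infinite fixed point `φ^∞(1)` (each `uW n` is a prefix of `uW (n+1)`,
and `|uW (i+1)| > i`, so the definition below gives the limit word). -/
def phiInf : ℕ → ℕ := fun i => (uW (i + 1)).getD i 0

/-- The periodic infinite word `\overline{w}` associated to a finite word `w`. -/
def periodicSeq (w : List ℕ) : ℕ → ℕ := fun i => w.getD (i % w.length) 0
/-- The infinite word `p \overline{w}`: the finite word `p` followed by the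
periodic repetition of `w`. -/
def prefixPeriodic (p w : List ℕ) : ℕ → ℕ :=
  fun i => if i < p.length then p.getD i 0 else w.getD ((i - p.length) % w.length) 0

/-- `vW 0 = 00`, `vW n = u_{n-1} u_{n-1}` for `n ≥ 1`. -/
def vW : ℕ → List ℕ
  | 0 => [0, 0]
  | n + 1 => uW n ++ uW n

namespace AltProof

def cns (a : ℕ) (x : ℕ → ℕ) : ℕ → ℕ
  | 0 => a
  | i + 1 => x i

def app : List ℕ → (ℕ → ℕ) → (ℕ → ℕ)
  | [], x => x
  | a :: w, x => cns a (app w x)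

def sh (x : ℕ → ℕ) : ℕ → ℕ := fun i => x (i + 1)

def pre (x : ℕ → ℕ) (N : ℕ) : List ℕ := (List.range N).map x

@[simp] theorem sh_cns (a x) : sh (cns a x) = x := rfl
@[simp] theorem cns_zero (a x) : cns a x 0 = a := rfl
@[simp] theorem cns_succ (a x i) : cns a x (i+1) = x i := rfl
theorem cns_sh (x : ℕ → ℕ) : cns (x 0) (sh x) = x := by
  funext i; cases i <;> rfl
theorem cns_sh' (x : ℕ → ℕ) {a : ℕ} (h : x 0 = a) : cns a (sh x) = x := by
  rw [← h, cns_sh]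

theorem app_append (w v x) : app (w ++ v) x = app w (app v x) := by
  induction w with
  | nil => rfl
  | cons a w ih => simp [app, ih]

theorem app_lt (w x) (j : ℕ) (h : j < w.length) : app w x j = w.getD j 0 := by
  induction w generalizing j with
  | nil => simp at h
  | cons a w ih =>
    cases j with
    | zero => rfl
    | succ j =>
      simp only [app, cns_succ, List.getD_cons_succ]
      exact ih j (by simpa using h)

theorem app_ge (w x) (j : ℕ) : app w x (w.length + j) = x j := by
  induction w with
  | nil => simp [app]
  | cons a w ih =>
    have : (a :: w).length + j = (w.length + j) + 1 := by simp; omega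
    rw [this]; simpa [app] using ih

@[simp] theorem pre_length (x N) : (pre x N).length = N := by simp [pre]

theorem pre_succ (x N) : pre x (N+1) = x 0 :: pre (sh x) N := by
  simp only [pre, List.range_succ_eq_map, List.map_cons, List.map_map]; rfl

theorem pre_succ' (x N) : pre x (N+1) = pre x N ++ [x N] := by
  simp [pre, List.range_succ]

theorem pre_app (w x N) : pre (app w x) (w.length + N) = w ++ pre x N := by
  induction w with
  | nil => simp [app]
  | cons a w ih =>
    have : (a :: w).length + N = (w.length + N) + 1 := by simp; omega
    rw [this, pre_succ]; simpa [app] using ih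

theorem pre_app' (w x N) (h : w.length ≤ N) : pre (app w x) N = w ++ pre x (N - w.length) := by
  rw [← pre_app]; congr 1; omega

theorem pre_add (x M N) : ∃ r, pre x (M + N) = pre x M ++ r := by
  induction N with
  | zero => exact ⟨[], by simp⟩
  | succ N ih =>
    obtain ⟨r, hr⟩ := ih
    exact ⟨r ++ [x (M+N)], by rw [← add_assoc, pre_succ', hr]; simp⟩

theorem take_pre (x M N) : (pre x (M + N)).take M = pre x M := by
  obtain ⟨r, hr⟩ := pre_add x M N
  rw [hr]; simp

/-! ### Order -/

theorem altLt_rec (x y : ℕ → ℕ) :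
    altLt x y ↔ y 0 < x 0 ∨ (x 0 = y 0 ∧ altLt (sh y) (sh x)) := by
  constructor
  · rintro ⟨k, h1, h2⟩
    cases k with
    | zero => left; simpa using h2
    | succ k =>
      right
      refine ⟨h1 0 (by omega), k, fun i hi => (h1 (i+1) (by omega)).symm, ?_⟩
      by_cases hk : Even k <;> simp [Nat.even_add_one, hk] at h2 ⊢ <;> exact h2
  · rintro (h | ⟨h0, k, h1, h2⟩)
    · exact ⟨0, by simp, by simpa using h⟩
    · refine ⟨k+1, ?_, ?_⟩
      · intro i hi
        cases i with
        | zero => exact h0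
        | succ i => exact (h1 i (by omega)).symm
      · by_cases hk : Even k <;> simp [Nat.even_add_one, hk] at h2 ⊢ <;> exact h2

theorem altLe_rec (x y : ℕ → ℕ) :
    altLe x y ↔ y 0 < x 0 ∨ (x 0 = y 0 ∧ altLe (sh y) (sh x)) := by
  unfold altLe
  rw [altLt_rec]
  constructor
  · rintro (rfl | h | h)
    · right; exact ⟨rfl, Or.inl rfl⟩
    · left; exact h
    · right; exact ⟨h.1, Or.inr h.2⟩
  · rintro (h | ⟨h, h' | h'⟩)
    · right; left; exact h
    · left; rw [← cns_sh x, ← cns_sh y, h, h']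
    · right; right; exact ⟨h, h'⟩

theorem altLt_asymm {x y : ℕ → ℕ} (h : altLt x y) : ¬ altLe y x := by
  obtain ⟨k, h1, h2⟩ := h
  induction k generalizing x y with
  | zero =>
    simp at h2
    rw [altLe_rec]; omega
  | succ k ih =>
    rw [altLe_rec]
    have := h1 0 (by omega)
    rintro (h | ⟨_, h⟩)
    · omega
    · refine ih (x := sh y) (y := sh x) (fun i hi => (h1 (i+1) (by omega)).symm) ?_ h
      by_cases hk : Even k <;> simp [Nat.even_add_one, hk] at h2 ⊢ <;> exact h2

theorem altLe_of_not {x y : ℕ → ℕ} (h : ¬ altLt y x) : altLe x y := by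
  by_cases hxy : x = y
  · exact Or.inl hxy
  · right
    have hex : ∃ k, x k ≠ y k := by
      by_contra hc; push Not at hc; exact hxy (funext hc)
    classical
    have h1 : ∀ i < Nat.find hex, x i = y i := fun i hi => by
      have := Nat.find_min hex hi; push Not at this; exact this
    have h2 := Nat.find_spec hex
    refine ⟨Nat.find hex, h1, ?_⟩
    by_contra hc
    apply h
    refine ⟨Nat.find hex, fun i hi => (h1 i hi).symm, ?_⟩
    split_ifs at hc ⊢ <;> omega

/-! ### The substitution on infinite words -/

def Phi (y : ℕ → ℕ) : ℕ → ℕ := fun j => (phiW (pre y (j+1))).getD j 0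

theorem phiL_length_pos (a) : 1 ≤ (phiL a).length := by
  unfold phiL; split_ifs <;> simp

theorem phiW_append (w v) : phiW (w ++ v) = phiW w ++ phiW v := by simp [phiW]
theorem phiW_cons (a v) : phiW (a :: v) = phiL a ++ phiW v := by simp [phiW]
@[simp] theorem phiW_nil : phiW [] = [] := rfl

theorem phiW_length (w) : w.length ≤ (phiW w).length := by
  induction w with
  | nil => simp
  | cons a w ih => rw [phiW_cons]; have := phiL_length_pos a; simp; omega

theorem Phi_eq (y : ℕ → ℕ) (j M : ℕ) (h : j + 1 ≤ M) : Phi y j = (phiW (pre y M)).getD j 0 := by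
  obtain ⟨r, rfl⟩ := Nat.exists_eq_add_of_le h
  obtain ⟨s, hs⟩ := pre_add y (j+1) r
  rw [hs, phiW_append, List.getD_append]
  · rfl
  · have := phiW_length (pre y (j+1)); simp at this; omega

theorem Phi_cns (a y) : Phi (cns a y) = app (phiL a) (Phi y) := by
  funext j
  have h1 := phiL_length_pos a
  by_cases h : j < (phiL a).length
  · rw [app_lt _ _ _ h, Phi, pre_succ, cns_zero, phiW_cons, List.getD_append _ _ _ _ h]
  · obtain ⟨i, rfl⟩ := Nat.exists_eq_add_of_le (not_lt.mp h)
    rw [app_ge, Phi, pre_succ, cns_zero, phiW_cons, List.getD_append_right _ _ _ _ (by omega),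
      sh_cns, Phi_eq y i ((phiL a).length + i) (by omega)]
    simp

theorem Phi_sh (y) : Phi y = app (phiL (y 0)) (Phi (sh y)) := by
  rw [← Phi_cns, cns_sh]

theorem Phi_app (w y) : Phi (app w y) = app (phiW w) (Phi y) := by
  induction w with
  | nil => rfl
  | cons a w ih => rw [app, Phi_cns, ih, phiW_cons, app_append]

theorem Phi_iter_app (n w y) : Phi^[n] (app w y) = app (phiW^[n] w) (Phi^[n] y) := by
  induction n generalizing w y with
  | zero => rfl
  | succ n ih => simp only [Function.iterate_succ_apply, Phi_app, ih]

theorem Phi_unique (X : ℕ → ℕ → ℕ) (y : ℕ → ℕ)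
    (h : ∀ i, X i = app (phiL (y i)) (X (i+1))) : X 0 = Phi y := by
  have key : ∀ i, X 0 = app (phiW (pre y i)) (X i) := by
    intro i
    induction i with
    | zero => rfl
    | succ i ih =>
      rw [pre_succ', phiW_append, app_append, ih, h i]; simp [phiW]
  funext j
  rw [key (j+1), app_lt]
  · rfl
  · have := phiW_length (pre y (j+1)); simp at this; omega

theorem Phi_zero (y) : Phi y 0 = 1 := by
  rw [Phi_sh]; unfold phiL; split_ifs <;> rfl

theorem Phi_le (y j) : Phi y j ≤ 1 := by
  have : ∀ w : List ℕ, ∀ j, (phiW w).getD j 0 ≤ 1 := by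
    intro w
    induction w with
    | nil => intro j; simp
    | cons a w ih =>
      intro j
      rw [phiW_cons]
      unfold phiL
      split_ifs
      · rcases j with _ | j
        · simp
        · simpa using ih j
      · rcases j with _ | _ | _ | j
        · simp
        · simp
        · simp
        · simpa using ih j
  exact this _ _

def Bin (x : ℕ → ℕ) : Prop := ∀ i, x i ≤ 1

theorem Phi_lt {x y : ℕ → ℕ} (hx : Bin x) (hy : Bin y) (h : altLt x y) :
    altLt (Phi x) (Phi y) := by
  obtain ⟨k, h1, h2⟩ := h
  induction k generalizing x y with
  | zero =>
    simp at h2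
    have a1 := hx 0
    have a2 : y 0 = 0 := by omega
    have a3 : x 0 = 1 := by omega
    rw [Phi_sh x, Phi_sh y, a2, a3]
    simp [phiL, app]
    rw [altLt_rec]; right
    refine ⟨rfl, ?_⟩
    rw [altLt_rec]; left
    simp [Phi_zero]
  | succ k ih =>
    have e := h1 0 (by omega)
    have := ih (x := sh y) (y := sh x) (fun i => hy _) (fun i => hx _)
      (fun i hi => (h1 (i+1) (by omega)).symm)
      (by by_cases hk : Even k <;> simp [Nat.even_add_one, hk] at h2 ⊢ <;> exact h2)
    rw [Phi_sh x, Phi_sh y, e]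
    unfold phiL
    split_ifs
    · simp only [app]
      rw [altLt_rec]; right; exact ⟨rfl, this⟩
    · simp only [app]
      rw [altLt_rec]; right; refine ⟨rfl, ?_⟩
      rw [altLt_rec]; right; refine ⟨rfl, ?_⟩
      rw [altLt_rec]; right; exact ⟨rfl, this⟩

theorem Phi_le_iff {x y : ℕ → ℕ} (hx : Bin x) (hy : Bin y) :
    altLe (Phi x) (Phi y) ↔ altLe x y := by
  constructor
  · intro h
    apply altLe_of_not
    intro h'
    exact altLt_asymm (Phi_lt hy hx h') h
  · rintro (rfl | h)
    · exact Or.inl rfl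
    · exact Or.inr (Phi_lt hx hy h)

/-! ### The Lyndon systems under the substitution -/

theorem shift_shift (x j k) : shiftSeq (shiftSeq x j) k = shiftSeq x (j + k) := by
  funext i; simp [shiftSeq, add_assoc]

theorem sh_shift (x j) : sh (shiftSeq x j) = shiftSeq x (j+1) := by
  funext i; simp [shiftSeq, sh]; congr 1; omega

theorem shift_mem {D x} (h : x ∈ LyndonSystem D) (k) : shiftSeq x k ∈ LyndonSystem D :=
  ⟨fun i => h.1 _, fun j => by rw [shift_shift]; exact h.2 _⟩

theorem shift_zero (x) : shiftSeq x 0 = x := by funext i; simp [shiftSeq]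

theorem sh_mem {D x} (h : x ∈ LyndonSystem D) : sh x ∈ LyndonSystem D := by
  have := shift_mem h 1
  rwa [← sh_shift x 0, shift_zero] at this

theorem le_of_mem {D x} (h : x ∈ LyndonSystem D) : altLe D x := by
  have := h.2 0; rwa [shift_zero] at this

theorem mem_of {D : ℕ → ℕ} (P : (ℕ → ℕ) → Prop) (h1 : ∀ x, P x → P (sh x))
    (h2 : ∀ x, P x → x 0 ≤ D 0 ∧ altLe D x) {x} (hx : P x) : x ∈ LyndonSystem D := by
  have h3 : ∀ k, P (shiftSeq x k) := by
    intro k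
    induction k with
    | zero => rwa [shift_zero]
    | succ k ih => rw [← sh_shift]; exact h1 _ ih
  exact ⟨fun i => by have := (h2 _ (h3 i)).1; simpa [shiftSeq] using this, fun k => (h2 _ (h3 k)).2⟩

theorem Phi_mem {D y : ℕ → ℕ} (hD : Bin D) (hD0 : D 0 = 1) (hy : y ∈ LyndonSystem D) :
    Phi y ∈ LyndonSystem (Phi D) := by
  have key : ∀ z ∈ LyndonSystem D, altLe (Phi D) (Phi z) := fun z hz =>
    (Phi_le_iff hD (fun i => hD0 ▸ hz.1 i)).2 (le_of_mem hz)
  refine mem_of (fun x => ∃ z ∈ LyndonSystem D, x = Phi z ∨ x = app [0] (Phi z) ∨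
    x = app [0,0] (Phi z)) ?_ ?_ ⟨y, hy, Or.inl rfl⟩
  · rintro x ⟨z, hz, rfl | rfl | rfl⟩
    · refine ⟨sh z, sh_mem hz, ?_⟩
      rw [Phi_sh z]; unfold phiL
      split_ifs
      · left; rfl
      · right; right; rfl
    · exact ⟨z, hz, Or.inl rfl⟩
    · exact ⟨z, hz, Or.inr (Or.inl rfl)⟩
  · rintro x ⟨z, hz, rfl | rfl | rfl⟩
    · exact ⟨by simp [Phi_zero], key z hz⟩
    · refine ⟨by simp [app], ?_⟩
      rw [altLe_rec]; left; simp [Phi_zero, app]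
    · refine ⟨by simp [app], ?_⟩
      rw [altLe_rec]; left; simp [Phi_zero, app]

theorem desub_step {D x : ℕ → ℕ} (hD0 : D 0 = 1)
    (hx : x ∈ LyndonSystem (Phi D)) (h0 : x 0 = 1) :
    ∃ a x', a ≤ 1 ∧ x = app (phiL a) x' ∧ x' ∈ LyndonSystem (Phi D) ∧ x' 0 = 1 := by
  have hb : ∀ i, x i ≤ 1 := fun i => by have := hx.1 i; rwa [Phi_zero] at this
  have h := le_of_mem hx
  rw [Phi_sh D, hD0] at h
  simp only [phiL, app, one_ne_zero, if_false] at h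
  rw [altLe_rec] at h
  simp only [cns_zero, sh_cns, h0, lt_irrefl, false_or, true_and] at h
  rw [altLe_rec] at h
  simp only [cns_zero, sh_cns] at h
  rcases h with h | ⟨h1, h⟩
  · have h1 : sh x 0 = 1 := le_antisymm (hb 1) h
    exact ⟨0, sh x, by simp, by simp [phiL, app, cns_sh' x h0], sh_mem hx, h1⟩
  · rw [altLe_rec] at h
    simp only [cns_zero, sh_cns, Nat.not_lt_zero, false_or] at h
    obtain ⟨h2, h⟩ := h
    rw [altLe_rec, Phi_zero] at h
    have h3 : sh (sh (sh x)) 0 = 1 := by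
      have := hb 3
      rcases h with h | h
      · change 1 < x 3 at h; omega
      · exact h.1
    refine ⟨1, sh (sh (sh x)), le_rfl, ?_, sh_mem (sh_mem (sh_mem hx)), h3⟩
    simp [phiL, app, cns_sh' _ h2.symm, cns_sh' _ h1, cns_sh' _ h0]

theorem desub {D x : ℕ → ℕ} (hD : Bin D) (hD0 : D 0 = 1)
    (hx : x ∈ LyndonSystem (Phi D)) (h0 : x 0 = 1) :
    ∃ y ∈ LyndonSystem D, x = Phi y := by
  let T := {x : ℕ → ℕ // x ∈ LyndonSystem (Phi D) ∧ x 0 = 1}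
  have step : ∀ t : T, ∃ p : ℕ × T, p.1 ≤ 1 ∧ t.1 = app (phiL p.1) p.2.1 := by
    rintro ⟨x, hx, h0⟩
    obtain ⟨a, x', ha, e, hx', h0'⟩ := desub_step hD0 hx h0
    exact ⟨(a, ⟨x', hx', h0'⟩), ha, e⟩
  choose f hf1 hf2 using step
  let X : ℕ → T := fun i => (fun t => (f t).2)^[i] ⟨x, hx, h0⟩
  let y : ℕ → ℕ := fun i => (f (X i)).1
  have hX : ∀ i, (X i).1 = app (phiL (y i)) (X (i+1)).1 := by
    intro i
    have : X (i+1) = (f (X i)).2 := Function.iterate_succ_apply' _ _ _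
    rw [this]; exact hf2 _
  have hXi : ∀ i, (X i).1 = Phi (shiftSeq y i) := by
    intro i
    refine Phi_unique (fun k => (X (i+k)).1) _ (fun k => ?_)
    exact hX (i+k)
  have hy : Bin y := fun i => hf1 _
  refine ⟨y, ⟨fun i => hD0 ▸ hy i, fun k => ?_⟩, ?_⟩
  · rw [← Phi_le_iff hD (y := shiftSeq y k) (fun i => hy _), ← hXi]
    exact le_of_mem (X k).2.1
  · have := hXi 0
    rwa [shift_zero] at this

def zeros : ℕ → ℕ := fun _ => 0

theorem decomp {x : ℕ → ℕ} (hb : Bin x) :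
    x = zeros ∨ ∃ k, x = app (List.replicate k 0) (shiftSeq x k) ∧ shiftSeq x k 0 = 1 := by
  by_cases hex : ∃ k, x k ≠ 0
  · right
    classical
    refine ⟨Nat.find hex, ?_, ?_⟩
    · funext j
      by_cases h : j < Nat.find hex
      · rw [app_lt _ _ _ (by simpa using h)]
        have := Nat.find_min hex h
        push Not at this
        rw [this]; simp [List.getD_replicate, h]
      · obtain ⟨i, hi⟩ := Nat.exists_eq_add_of_le (not_lt.mp h)
        have := app_ge (List.replicate (Nat.find hex) 0) (shiftSeq x (Nat.find hex)) i
        rw [List.length_replicate] at this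
        rw [hi, this]; rfl
    · have := Nat.find_spec hex
      have := hb (Nat.find hex)
      simp only [shiftSeq, add_zero]; omega
  · left; push Not at hex; exact funext hex

/-! ### The words -/

def dS (n : ℕ) : ℕ → ℕ := prefixPeriodic (uW n) (vW n)

theorem uW_succ (n) : uW (n+1) = phiW (uW n) := Function.iterate_succ_apply' _ _ _
theorem vW_succ (n) : vW (n+1) = phiW (vW n) := by
  cases n with
  | zero => rfl
  | succ n => simp only [vW, phiW_append, uW_succ]
theorem vW_iter (n) : vW n = phiW^[n] [0,0] := by
  induction n with
  | zero => rfl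
  | succ n ih => rw [vW_succ, ih, Function.iterate_succ_apply']
theorem uW_split (n) : uW (n+1) = uW n ++ vW n := by
  induction n with
  | zero => rfl
  | succ n ih => rw [uW_succ, ih, phiW_append, ← uW_succ, ← vW_succ, ih]

theorem incomp (n) : ∀ a b : List ℕ, uW n ++ a ≠ vW n ++ b := by
  induction n with
  | zero => intro a b; simp [uW, vW]
  | succ n ih =>
    intro a b h
    rw [uW_split, vW, List.append_assoc, List.append_assoc] at h
    exact ih _ _ (List.append_cancel_left h).symm

theorem lens (n) : (1 ≤ (uW n).length ∧ 2 ≤ (vW n).length) ∧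
    ((vW n).length = (uW n).length + 1 ∨ (uW n).length = (vW n).length + 1) := by
  induction n with
  | zero => simp [uW, vW]
  | succ n ih => rw [uW_split, vW]; simp only [List.length_append]; omega

theorem per_unique {z : ℕ → ℕ} {w : List ℕ} (hw : 0 < w.length) (h : z = app w z) :
    ∀ i, z i = w.getD (i % w.length) 0 := by
  intro i
  induction i using Nat.strong_induction_on with
  | _ i ih =>
    by_cases hi : i < w.length
    · rw [h, app_lt _ _ _ hi, Nat.mod_eq_of_lt hi]
    · obtain ⟨j, rfl⟩ := Nat.exists_eq_add_of_le (not_lt.mp hi)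
      rw [h, app_ge, ih j (by omega)]; simp

theorem per_app {w : List ℕ} (hw : 0 < w.length) : periodicSeq w = app w (periodicSeq w) := by
  funext i
  by_cases hi : i < w.length
  · rw [app_lt _ _ _ hi, periodicSeq, Nat.mod_eq_of_lt hi]
  · obtain ⟨j, rfl⟩ := Nat.exists_eq_add_of_le (not_lt.mp hi)
    rw [app_ge]; simp [periodicSeq]

theorem pp_eq (u v) : prefixPeriodic u v = app u (periodicSeq v) := by
  funext i
  unfold prefixPeriodic
  split_ifs with hi
  · rw [app_lt _ _ _ hi]
  · obtain ⟨j, rfl⟩ := Nat.exists_eq_add_of_le (not_lt.mp hi)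
    rw [app_ge]; simp [periodicSeq]

theorem dS_succ (n) : dS (n+1) = Phi (dS n) := by
  have h1 := (lens n).1.2
  unfold dS
  rw [pp_eq, pp_eq, Phi_app, uW_succ, vW_succ]
  congr 1
  have h := congrArg Phi (per_app (w := vW n) (by omega))
  rw [Phi_app] at h
  have h2 := phiW_length (vW n)
  funext i
  exact (per_unique (by omega) h i).symm

theorem dS_zero : dS 0 = cns 1 zeros := by
  funext i
  rcases i with _ | i
  · rfl
  · simp [dS, prefixPeriodic, uW, vW, zeros]
    rcases Nat.mod_two_eq_zero_or_one i with h | h <;> simp [h]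

theorem dS_bin (n) : Bin (dS n) := by
  cases n with
  | zero => rw [dS_zero]; intro i; cases i <;> simp [zeros]
  | succ n => rw [dS_succ]; exact Phi_le _

theorem dS_head (n) : dS n 0 = 1 := by
  cases n with
  | zero => rw [dS_zero]; rfl
  | succ n => rw [dS_succ]; exact Phi_zero _

def M (n : ℕ) : Set (ℕ → ℕ) := LyndonSystem (dS n)

theorem M_bin {n x} (h : x ∈ M n) : Bin x := fun i => dS_head n ▸ h.1 i

theorem M_succ {n x} (h : x ∈ M (n+1)) :
    x = zeros ∨ ∃ k, ∃ y ∈ M n, x = app (List.replicate k 0) (Phi y) := by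
  rcases decomp (M_bin h) with h1 | ⟨k, h1, h2⟩
  · exact Or.inl h1
  · right
    have h3 := shift_mem h k
    rw [dS_succ] at h3
    obtain ⟨y, hy, e⟩ := desub (dS_bin n) (dS_head n) h3 h2
    exact ⟨k, y, hy, e ▸ h1⟩

/-! ### Level zero -/

def Z0 : Set (ℕ → ℕ) := {x | cns 1 x ∈ M 0}

theorem M0_mem {x : ℕ → ℕ} (hx : x ∈ M 0) (h : x 0 = 0 ∨ x 0 = 1) : cns (x 0) (sh x) ∈ M 0 := by
  rwa [cns_sh]

theorem M0_cns {a x} (ha : a ≤ 1) (hx : x ∈ M 0) (h : altLe (dS 0) (cns a x)) : cns a x ∈ M 0 := by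
  refine mem_of (fun z => z = cns a x ∨ z ∈ M 0) ?_ ?_ (Or.inl rfl)
  · rintro z (rfl | hz)
    · exact Or.inr hx
    · exact Or.inr (sh_mem hz)
  · rintro z (rfl | hz)
    · exact ⟨by rw [dS_head]; exact ha, h⟩
    · exact ⟨hz.1 0, le_of_mem hz⟩

theorem le0 (x) : altLe (dS 0) (cns 1 x) ↔ altLe x zeros := by
  rw [dS_zero, altLe_rec]; simp

theorem lez (x) : altLe (cns 0 (cns 0 x)) zeros ↔ altLe x zeros := by
  have hz : sh zeros = zeros := rfl
  rw [altLe_rec]; simp [zeros]; rw [altLe_rec]; simp [zeros, sh]; rfl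

theorem M0_zero {x} (hx : x ∈ M 0) : cns 0 x ∈ M 0 := by
  refine M0_cns (by simp) hx ?_
  rw [dS_zero, altLe_rec]; left; simp

theorem Z0_sub {x} (h : x ∈ Z0) : x ∈ M 0 := sh_mem h

theorem Z0_one {x} (h : x ∈ Z0) : app [1] x ∈ Z0 := by
  refine M0_cns le_rfl h ?_
  rw [le0, altLe_rec]; left; simp [zeros, app]

theorem Z0_two {x} (h : x ∈ Z0) : app [0,0] x ∈ Z0 := by
  refine M0_cns le_rfl (M0_zero (M0_zero (Z0_sub h))) ?_
  rw [le0]; simp only [app]; rw [lez, ← le0]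
  exact le_of_mem h

theorem Z0_dec {x} (h : x ∈ Z0) : ∃ y ∈ Z0, x = app [1] y ∨ x = app [0,0] y := by
  have hb := M_bin (Z0_sub h)
  have hle := le_of_mem h
  rw [le0] at hle
  rcases Nat.le_one_iff_eq_zero_or_eq_one.1 (hb 0) with h0 | h0
  · have h1 : sh x 0 = 0 := by
      rw [altLe_rec] at hle
      simp only [h0, zeros, lt_irrefl, false_or, true_and] at hle
      rw [altLe_rec] at hle
      rcases hle with hle | hle
      · exact absurd hle (Nat.not_lt_zero _)
      · exact hle.1.symm
    have e : x = cns 0 (cns 0 (sh (sh x))) := by rw [cns_sh' _ h1, cns_sh' _ h0]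
    refine ⟨sh (sh x), ?_, Or.inr e⟩
    refine M0_cns le_rfl (sh_mem (sh_mem (Z0_sub h))) ?_
    rw [le0]; rw [e, lez] at hle; exact hle
  · refine ⟨sh x, ?_, Or.inl (cns_sh' x h0).symm⟩
    change cns 1 (sh x) ∈ M 0
    rw [cns_sh' x h0]; exact Z0_sub h

theorem M0_dec {x} (h : x ∈ M 0) :
    x = zeros ∨ ∃ k, ∃ y ∈ Z0, x = app (List.replicate k 0) y := by
  rcases decomp (M_bin h) with h1 | ⟨k, h1, h2⟩
  · exact Or.inl h1
  · right
    refine ⟨k, _, ?_, h1⟩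
    have : shiftSeq x k ∈ M 0 := shift_mem h k
    have h3 := Z0_one (x := sh (shiftSeq x k)) (by
      change cns 1 _ ∈ M 0
      rwa [cns_sh' _ h2])
    simp only [app] at h3
    rwa [cns_sh' _ h2] at h3

theorem Z0_ne : Z0.Nonempty := by
  refine ⟨zeros, M0_cns le_rfl ?_ ?_⟩
  · refine mem_of (fun z => z = zeros) (fun x h => by subst h; rfl) ?_ rfl
    rintro x rfl
    refine ⟨by simp [zeros], ?_⟩
    rw [dS_zero, altLe_rec]; left; simp [zeros]
  · rw [le0]; exact Or.inl rfl

/-! ### Counting -/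

def P (X : Set (ℕ → ℕ)) (N : ℕ) : Set (List ℕ) := (fun x => pre x N) '' X

def BinSet (X : Set (ℕ → ℕ)) : Prop := ∀ x ∈ X, Bin x

theorem P_finite {X} (hX : BinSet X) (N) : (P X N).Finite := by
  have : ∀ N, {w : List ℕ | ∃ x, Bin x ∧ w = pre x N}.Finite := by
    intro N
    induction N with
    | zero =>
      refine (Set.finite_singleton []).subset ?_
      rintro w ⟨x, _, rfl⟩; rfl
    | succ N ih =>
      refine ((Set.finite_Iic 1).image2 (fun a w => a :: w) ih).subset ?_
      rintro w ⟨x, hx, rfl⟩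
      exact ⟨x 0, hx 0, pre (sh x) N, ⟨sh x, fun i => hx _, rfl⟩, (pre_succ x N).symm⟩
  refine (this N).subset ?_
  rintro _ ⟨x, hx, rfl⟩
  exact ⟨x, hX x hx, rfl⟩

theorem Hword_eq (D N) : Hword D N = (P (LyndonSystem D) N).ncard := by
  unfold Hword
  congr 1
  ext w
  constructor
  · rintro ⟨⟨x, hx, k, hk⟩, rfl⟩
    exact ⟨shiftSeq x k, shift_mem hx k, hk.symm⟩
  · rintro ⟨x, hx, rfl⟩
    refine ⟨⟨x, hx, 0, ?_⟩, by simp⟩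
    simp [pre]

theorem P_step {X Y : Set (ℕ → ℕ)} (hX : BinSet X) (z : ℕ → ℕ) (w : ℕ → List ℕ)
    (hw : ∀ k, ∃ r, w (k+1) = w k ++ r) (hl : ∀ k, k ≤ (w k).length)
    (h : ∀ y ∈ Y, y = z ∨ ∃ k, ∃ x ∈ X, y = app (w k) x) (N : ℕ) :
    (P Y N).ncard ≤ 1 + (N+1) * (P X N).ncard := by
  have hsub : P Y N ⊆ {pre z N} ∪
      (fun p : ℕ × List ℕ => (w p.1 ++ p.2).take N) '' (Set.Iic N ×ˢ P X N) := by
    rintro _ ⟨y, hy, rfl⟩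
    rcases h y hy with rfl | ⟨k, x, hx, rfl⟩
    · left; rfl
    · right
      have e : pre (app (w k) x) N = (w k ++ pre x N).take N := by
        rw [← pre_app, add_comm, take_pre]
      by_cases hk : k ≤ N
      · exact ⟨(k, pre x N), ⟨hk, x, hx, rfl⟩, e.symm⟩
      · refine ⟨(N, pre x N), ⟨le_refl N, x, hx, rfl⟩, ?_⟩
        simp only
        rw [e]
        have hpre : ∀ j, ∃ r, w (N + j) = w N ++ r := by
          intro j
          induction j with
          | zero => exact ⟨[], by simp⟩
          | succ j ih =>
            obtain ⟨r, hr⟩ := ih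
            obtain ⟨s, hs⟩ := hw (N + j)
            exact ⟨r ++ s, by rw [← add_assoc, hs, hr]; simp⟩
        obtain ⟨j, rfl⟩ := Nat.exists_eq_add_of_le (not_le.mp hk).le
        obtain ⟨r, hr⟩ := hpre j
        rw [hr, List.append_assoc, List.take_append_of_le_length (hl N),
          List.take_append_of_le_length (hl N)]
  have hfin : (Set.Iic N ×ˢ P X N).Finite := (Set.finite_Iic N).prod (P_finite hX N)
  calc (P Y N).ncard ≤ _ := Set.ncard_le_ncard hsub ((Set.finite_singleton _).union (hfin.image _))
    _ ≤ _ := Set.ncard_union_le _ _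
    _ ≤ 1 + (Set.Iic N ×ˢ P X N).ncard := by
      rw [Set.ncard_singleton]; exact Nat.add_le_add_left (Set.ncard_image_le hfin) 1
    _ = _ := by
      rw [Set.ncard_prod]; congr 2
      rw [← Finset.coe_Iic, Set.ncard_coe_finset]; simp

def U (γ : ℝ) (X : Set (ℕ → ℕ)) : Prop :=
  ∃ C : ℝ, 0 < C ∧ ∃ k : ℕ, ∀ N : ℕ, ((P X N).ncard : ℝ) ≤ C * (N+1)^k * γ^N

theorem U_step {γ : ℝ} (hγ : 1 < γ) {X Y : Set (ℕ → ℕ)} (hX : BinSet X) (z : ℕ → ℕ)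
    (w : ℕ → List ℕ)
    (hw : ∀ k, ∃ r, w (k+1) = w k ++ r) (hl : ∀ k, k ≤ (w k).length)
    (h : ∀ y ∈ Y, y = z ∨ ∃ k, ∃ x ∈ X, y = app (w k) x) (hU : U γ X) : U γ Y := by
  obtain ⟨C, hC, k, hk⟩ := hU
  refine ⟨C + 1, by linarith, k+1, fun N => ?_⟩
  have h1 : ((P Y N).ncard : ℝ) ≤ 1 + (N+1) * (P X N).ncard := by
    exact_mod_cast P_step hX z w hw hl h N
  have h2 : (1:ℝ) ≤ ((N:ℝ)+1)^(k+1) * γ^N :=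
    one_le_mul_of_one_le_of_one_le (one_le_pow₀ (by simp)) (one_le_pow₀ hγ.le)
  have h3 : ((N:ℝ)+1) * (P X N).ncard ≤ (N+1) * (C * (N+1)^k * γ^N) :=
    mul_le_mul_of_nonneg_left (hk N) (by positivity)
  calc ((P Y N).ncard : ℝ) ≤ 1 + (N+1) * (P X N).ncard := h1
    _ ≤ ((N:ℝ)+1)^(k+1) * γ^N + (N+1) * (C * (N+1)^k * γ^N) := add_le_add h2 h3
    _ = _ := by ring

theorem iter_rep (j k) : ∃ r, phiW^[j] (List.replicate (k+1) 0) =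
    phiW^[j] (List.replicate k 0) ++ r := by
  refine ⟨phiW^[j] [0], ?_⟩
  rw [List.replicate_succ']
  generalize List.replicate k 0 = a
  generalize [0] = b
  induction j generalizing a b with
  | zero => rfl
  | succ j ih => simp only [Function.iterate_succ_apply, phiW_append, ih]

theorem iter_len (j k) : k ≤ (phiW^[j] (List.replicate k 0)).length := by
  induction j with
  | zero => simp
  | succ j ih => rw [Function.iterate_succ_apply']; exact ih.trans (phiW_length _)

theorem iter_bin {X} (hX : BinSet X) (j) : BinSet (Phi^[j] '' X) := by
  cases j with
  | zero => simpa using hX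
  | succ j =>
    rintro _ ⟨x, hx, rfl⟩
    rw [Function.iterate_succ_apply']; exact Phi_le _

theorem Z0_bin : BinSet Z0 := fun _ hx => M_bin (Z0_sub hx)

theorem U_M {γ : ℝ} (hγ : 1 < γ) (m j : ℕ) (h : U γ (Phi^[j+m] '' Z0)) :
    U γ (Phi^[j] '' M m) := by
  induction m generalizing j with
  | zero =>
    refine U_step hγ (iter_bin Z0_bin j) (Phi^[j] zeros) (fun k => phiW^[j] (List.replicate k 0))
      (iter_rep j) (iter_len j) ?_ h
    rintro _ ⟨x, hx, rfl⟩
    rcases M0_dec hx with rfl | ⟨k, y, hy, rfl⟩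
    · exact Or.inl rfl
    · exact Or.inr ⟨k, _, ⟨y, hy, rfl⟩, Phi_iter_app _ _ _⟩
  | succ m ih =>
    have h' := ih (j+1) (by rwa [show j + 1 + m = j + (m+1) by omega])
    refine U_step hγ (iter_bin (fun x hx => M_bin hx) (j+1)) (Phi^[j] zeros)
      (fun k => phiW^[j] (List.replicate k 0)) (iter_rep j) (iter_len j) ?_ h'
    rintro _ ⟨x, hx, rfl⟩
    rcases M_succ hx with rfl | ⟨k, y, hy, rfl⟩
    · exact Or.inl rfl
    · refine Or.inr ⟨k, _, ⟨y, hy, rfl⟩, ?_⟩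
      rw [Phi_iter_app, Function.iterate_succ_apply]

def Z (n : ℕ) : Set (ℕ → ℕ) := Phi^[n] '' Z0

theorem Z_sub (n) : Z n ⊆ M n := by
  induction n with
  | zero => rintro _ ⟨x, hx, rfl⟩; exact Z0_sub hx
  | succ n ih =>
    rintro _ ⟨x, hx, rfl⟩
    rw [Function.iterate_succ_apply', M, dS_succ]
    exact Phi_mem (dS_bin n) (dS_head n) (ih ⟨x, hx, rfl⟩)

theorem Z_rec (n) : Z n = app (uW n) '' Z n ∪ app (vW n) '' Z n := by
  ext x
  constructor
  · rintro ⟨x, hx, rfl⟩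
    obtain ⟨y, hy, rfl | rfl⟩ := Z0_dec hx
    · left; exact ⟨_, ⟨y, hy, rfl⟩, (Phi_iter_app _ _ _).symm⟩
    · right; refine ⟨_, ⟨y, hy, rfl⟩, ?_⟩
      rw [vW_iter]; exact (Phi_iter_app _ _ _).symm
  · rintro (⟨_, ⟨y, hy, rfl⟩, rfl⟩ | ⟨_, ⟨y, hy, rfl⟩, rfl⟩)
    · exact ⟨_, Z0_one hy, Phi_iter_app _ _ _⟩
    · refine ⟨_, Z0_two hy, ?_⟩
      rw [vW_iter]; exact Phi_iter_app _ _ _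

theorem Z_bin (n) : BinSet (Z n) := iter_bin Z0_bin n

theorem P_app (X w N) (h : w.length ≤ N) :
    P (app w '' X) N = (fun l => w ++ l) '' P X (N - w.length) := by
  unfold P
  rw [Set.image_image, Set.image_image]
  exact Set.image_congr' (fun x => pre_app' _ _ _ h)

theorem PZ_rec (n N) (h1 : (uW n).length ≤ N) (h2 : (vW n).length ≤ N) :
    (P (Z n) N).ncard = (P (Z n) (N - (uW n).length)).ncard
      + (P (Z n) (N - (vW n).length)).ncard := by
  have e : P (Z n) N = (fun l => uW n ++ l) '' P (Z n) (N - (uW n).length) ∪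
      (fun l => vW n ++ l) '' P (Z n) (N - (vW n).length) := by
    rw [← P_app _ _ _ h1, ← P_app _ _ _ h2]
    conv_lhs => rw [Z_rec n]
    exact Set.image_union _ _ _
  rw [e, Set.ncard_union_eq ?_ ((P_finite (Z_bin n) _).image _)
    ((P_finite (Z_bin n) _).image _), Set.ncard_image_of_injective, Set.ncard_image_of_injective]
  · intro a b h; simpa using h
  · intro a b h; simpa using h
  · rw [Set.disjoint_left]
    rintro _ ⟨a, _, rfl⟩ ⟨b, _, hb⟩
    exact incomp n a b hb.symm

theorem P_pos {X} (hX : BinSet X) (hne : X.Nonempty) (N) : 1 ≤ (P X N).ncard :=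
  (Set.ncard_pos (P_finite hX N)).2 (hne.image _)

theorem exists_gamma {l : ℕ} (hl : 2 ≤ l) : ∃ γ : ℝ, 1 < γ ∧ γ ^ l = γ + 1 := by
  have hc : ContinuousOn (fun x : ℝ => x ^ l - (x + 1)) (Set.Icc 1 2) := by fun_prop
  have h4 : (2:ℝ)^2 ≤ 2^l := pow_le_pow_right₀ (by norm_num) hl
  have := intermediate_value_Icc (by norm_num : (1:ℝ) ≤ 2) hc
  obtain ⟨γ, hγ, h⟩ := this (show (0:ℝ) ∈ _ by
    constructor
    · norm_num
    · norm_num at h4 ⊢; linarith)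
  simp only at h
  refine ⟨γ, lt_of_le_of_ne hγ.1 ?_, by linarith⟩
  rintro rfl
  norm_num at h

theorem gamma_rec {γ : ℝ} (n N : ℕ) (hγ : γ ^ max (uW n).length (vW n).length = γ + 1)
    (h1 : max (uW n).length (vW n).length ≤ N) :
    γ ^ (N - (uW n).length) + γ ^ (N - (vW n).length) = γ ^ N := by
  obtain ⟨j, rfl⟩ := Nat.exists_eq_add_of_le h1
  rw [pow_add, hγ]
  rcases (lens n).2 with h | h
  · rw [h, max_eq_right (by omega), show (uW n).length + 1 + j - (uW n).length = j + 1 by omega,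
      show (uW n).length + 1 + j - ((uW n).length + 1) = j by omega]; ring
  · rw [h, max_eq_left (by omega), show (vW n).length + 1 + j - (vW n).length = j + 1 by omega,
      show (vW n).length + 1 + j - ((vW n).length + 1) = j by omega]; ring

theorem Z_upper {γ : ℝ} (n : ℕ) (h1 : 1 < γ)
    (hγ : γ ^ max (uW n).length (vW n).length = γ + 1) : U γ (Z n) := by
  set l := max (uW n).length (vW n).length with hl
  set C : ℝ := 1 + ∑ i ∈ Finset.range l, ((P (Z n) i).ncard : ℝ) with hC
  have hC0 : 0 < C := by positivity
  refine ⟨C, hC0, 0, fun N => ?_⟩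
  rw [pow_zero, mul_one]
  induction N using Nat.strong_induction_on with
  | _ N ih =>
    have hpos := (lens n).1
    by_cases h : N < l
    · have a1 : ((P (Z n) N).ncard : ℝ) ≤ ∑ i ∈ Finset.range l, ((P (Z n) i).ncard : ℝ) :=
        Finset.single_le_sum (f := fun i => ((P (Z n) i).ncard : ℝ)) (fun i _ => by positivity)
          (Finset.mem_range.2 h)
      have a2 : (1:ℝ) ≤ γ^N := one_le_pow₀ h1.le
      nlinarith
    · push Not at h
      have hu : (uW n).length ≤ N := (le_max_left _ _).trans h
      have hv : (vW n).length ≤ N := (le_max_right _ _).trans h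
      rw [PZ_rec n N hu hv, ← gamma_rec n N hγ h]
      push_cast
      rw [mul_add]
      exact add_le_add (ih _ (by omega)) (ih _ (by omega))

theorem Z_lower {γ : ℝ} (n : ℕ) (h1 : 1 < γ)
    (hγ : γ ^ max (uW n).length (vW n).length = γ + 1) :
    ∃ c : ℝ, 0 < c ∧ ∀ N, c * γ^N ≤ ((P (Z n) N).ncard : ℝ) := by
  set l := max (uW n).length (vW n).length with hl
  have hp : 0 < γ ^ l := by positivity
  refine ⟨(γ^l)⁻¹, by positivity, fun N => ?_⟩
  induction N using Nat.strong_induction_on with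
  | _ N ih =>
    have hpos := (lens n).1
    by_cases h : N < l
    · have a1 : (1:ℝ) ≤ ((P (Z n) N).ncard : ℝ) := by
        exact_mod_cast P_pos (Z_bin n) (Z0_ne.image _) N
      have a2 : γ^N ≤ γ^l := pow_le_pow_right₀ h1.le h.le
      have : (γ^l)⁻¹ * γ^N ≤ 1 := by
        rw [inv_mul_le_iff₀ hp]; simpa using a2
      linarith
    · push Not at h
      have hu : (uW n).length ≤ N := (le_max_left _ _).trans h
      have hv : (vW n).length ≤ N := (le_max_right _ _).trans h
      rw [PZ_rec n N hu hv, ← gamma_rec n N hγ h]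
      push_cast
      rw [mul_add]
      exact add_le_add (ih _ (by omega)) (ih _ (by omega))

theorem log_lim (c C γ : ℝ) (k : ℕ) (H : ℕ → ℕ) (hc : 0 < c) (hC : 0 < C) (hγ : 1 < γ)
    (h1 : ∀ N, c * γ^N ≤ (H N : ℝ)) (h2 : ∀ N : ℕ, (H N : ℝ) ≤ C * (N+1)^k * γ^N) :
    Filter.Tendsto (fun n : ℕ => Real.log (H n) / n) Filter.atTop (nhds (Real.log γ)) := by
  have hγ0 : 0 < γ := by linarith
  have t1 : ∀ a : ℝ, Filter.Tendsto (fun n : ℕ => a / (n:ℝ)) Filter.atTop (nhds 0) :=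
    fun a => tendsto_const_div_atTop_nhds_zero_nat a
  have t2 : Filter.Tendsto (fun n : ℕ => Real.log ((n:ℝ)+1) / (n:ℝ)) Filter.atTop (nhds 0) := by
    have := (Real.tendsto_pow_log_div_mul_add_atTop 1 (-1) 1 one_ne_zero).comp
      (Filter.tendsto_atTop_add_const_right _ (1:ℝ) tendsto_natCast_atTop_atTop)
    refine this.congr (fun n => ?_)
    simp
  have lo : Filter.Tendsto (fun n : ℕ => Real.log c / n + Real.log γ) Filter.atTop
      (nhds (Real.log γ)) := by simpa using (t1 (Real.log c)).add_const (Real.log γ)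
  have hi : Filter.Tendsto (fun n : ℕ => Real.log C / n + k * (Real.log ((n:ℝ)+1) / n) + Real.log γ)
      Filter.atTop (nhds (Real.log γ)) := by
    simpa using ((t1 (Real.log C)).add (t2.const_mul (k:ℝ))).add_const (Real.log γ)
  refine tendsto_of_tendsto_of_tendsto_of_le_of_le' lo hi ?_ ?_
  · filter_upwards [Filter.eventually_gt_atTop 0] with N hN
    have hN' : (0:ℝ) < N := by exact_mod_cast hN
    have := Real.log_le_log (by positivity) (h1 N)
    rw [Real.log_mul (by positivity) (by positivity), Real.log_pow] at this
    rw [le_div_iff₀ hN']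
    field_simp
    linarith
  · filter_upwards [Filter.eventually_gt_atTop 0] with N hN
    have hN' : (0:ℝ) < N := by exact_mod_cast hN
    have hH : (0:ℝ) < H N := lt_of_lt_of_le (by positivity) (h1 N)
    have := Real.log_le_log hH (h2 N)
    rw [Real.log_mul (by positivity) (by positivity), Real.log_mul (by positivity) (by positivity),
      Real.log_pow, Real.log_pow] at this
    rw [div_le_iff₀ hN']
    field_simp
    linarith

end AltProof

/-- Proposition 5 (1): for every `n`, the Lyndon system of `u_n \overline{v_n}` has
entropy `log γ_n > 0`, where `γ_n > 1` satisfies `γ_n^{l_n} = γ_n + 1` with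
`l_n = max(|u_n|, |v_n|)`. -/
theorem stmt8 (n : ℕ) :
    ∃ γ : ℝ, 1 < γ ∧ γ ^ max (uW n).length (vW n).length = γ + 1 ∧
      0 < Real.log γ ∧ EntropyIs (prefixPeriodic (uW n) (vW n)) (Real.log γ) := by
  have hlen := AltProof.lens n
  obtain ⟨γ, h1, hγ⟩ := AltProof.exists_gamma
    (l := max (uW n).length (vW n).length) (le_max_of_le_right hlen.1.2)
  refine ⟨γ, h1, hγ, Real.log_pos h1, ?_⟩
  obtain ⟨c, hc, hlow⟩ := AltProof.Z_lower n h1 hγ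
  obtain ⟨C, hC, k, hup⟩ := AltProof.U_M h1 n 0 (by rw [zero_add]; exact AltProof.Z_upper n h1 hγ)
  refine AltProof.log_lim c C γ k _ hc hC h1 (fun N => (hlow N).trans ?_) (fun N => ?_)
  · rw [AltProof.Hword_eq]
    exact_mod_cast Set.ncard_le_ncard (Set.image_mono (AltProof.Z_sub n))
      (AltProof.P_finite (fun x hx => AltProof.M_bin (n := n) hx) N)
  · rw [AltProof.Hword_eq]
    have := hup N
    simp only [Function.iterate_zero, Set.image_id] at this
    exact this
end

section
/- Let (d_i)_{i≥1} be an alternate Lyndon word over a finite alphabet A = {0,1,…,d_1} and let M be the associated Lyndon system. Then M has strictly positive topological entropy if and only if (d_i)_{i≥1} ≺ φ^∞(1) in the alternate order. -/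
open Filter Topology

/-! ### The alternate order -/

theorem altLt_asymm {x y : ℕ → ℕ} (h : altLt x y) (h' : altLt y x) : False := by
  obtain ⟨k, hk, hk'⟩ := h
  obtain ⟨l, hl, hl'⟩ := h'
  rcases lt_trichotomy k l with h | h | h
  · have := hl k h
    split_ifs at hk' <;> omega
  · subst h
    split_ifs at hk' hl' <;> omega
  · have := hk l h
    split_ifs at hl' <;> omega

theorem altLt_irrefl {x : ℕ → ℕ} (h : altLt x x) : False := altLt_asymm h h

theorem altLt_tri (x y : ℕ → ℕ) : x = y ∨ altLt x y ∨ altLt y x := by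
  classical
  by_cases h : ∃ k, x k ≠ y k
  · right
    have h1 := Nat.find_spec h
    have h2 : ∀ i < Nat.find h, x i = y i := fun i hi => by
      by_contra hc
      exact Nat.find_min h hi hc
    generalize Nat.find h = k at h1 h2
    have h3 : ∀ i < k, y i = x i := fun i hi => (h2 i hi).symm
    rcases lt_or_gt_of_ne h1 with h4 | h4 <;> by_cases hk : Even k
    · exact Or.inr ⟨k, h3, by simpa [hk] using h4⟩
    · exact Or.inl ⟨k, h2, by simpa [hk] using h4⟩
    · exact Or.inl ⟨k, h2, by simpa [hk] using h4⟩
    · exact Or.inr ⟨k, h3, by simpa [hk] using h4⟩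
  · left
    push Not at h
    exact funext h

theorem altLt_trans {x y z : ℕ → ℕ} (h : altLt x y) (h' : altLt y z) : altLt x z := by
  obtain ⟨k, hk, hk'⟩ := h
  obtain ⟨l, hl, hl'⟩ := h'
  rcases lt_trichotomy k l with h | h | h
  · refine ⟨k, fun i hi => (hk i hi).trans (hl i (hi.trans h)), ?_⟩
    rw [← hl k h]; exact hk'
  · subst h
    refine ⟨k, fun i hi => (hk i hi).trans (hl i hi), ?_⟩
    split_ifs at hk' hl' ⊢ <;> omega
  · refine ⟨l, fun i hi => (hk i (hi.trans h)).trans (hl i hi), ?_⟩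
    rw [hk l h]; exact hl'

theorem altLe_trans {x y z : ℕ → ℕ} (h : altLe x y) (h' : altLe y z) : altLe x z := by
  rcases h with rfl | h
  · exact h'
  · rcases h' with rfl | h'
    · exact Or.inr h
    · exact Or.inr (altLt_trans h h')

theorem altLe_of_not {x y : ℕ → ℕ} (h : ¬ altLt y x) : altLe x y := by
  rcases altLt_tri x y with h1 | h1 | h1
  · exact Or.inl h1
  · exact Or.inr h1
  · exact absurd h1 h

theorem not_altLt_of_le {x y : ℕ → ℕ} (h : altLe x y) : ¬ altLt y x := by
  intro h'
  rcases h with rfl | h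
  · exact altLt_irrefl h'
  · exact altLt_asymm h h'

theorem altLe_zero {x y : ℕ → ℕ} (h : altLe x y) : y 0 ≤ x 0 := by
  rcases h with rfl | ⟨k, hk, hk'⟩
  · exact le_rfl
  · rcases k with _ | k
    · simp at hk'; omega
    · exact (hk 0 (by omega)).ge

/-! ### The substitution on infinite sequences -/

/-- Starting position of the `k`-th block of the image of `y`. -/
def posP (y : ℕ → ℕ) : ℕ → ℕ
  | 0 => 0
  | k + 1 => posP y k + (if y k = 0 then 1 else 3)

/-- `x` is the image of `y` under the substitution. -/
def RelP (y x : ℕ → ℕ) : Prop :=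
  ∀ k, x (posP y k) = 1 ∧ (y k ≠ 0 → x (posP y k + 1) = 0 ∧ x (posP y k + 2) = 0)

theorem posP_succ_zero {y : ℕ → ℕ} {k : ℕ} (h : y k = 0) : posP y (k + 1) = posP y k + 1 := by
  simp [posP, h]

theorem posP_succ_ne {y : ℕ → ℕ} {k : ℕ} (h : y k ≠ 0) : posP y (k + 1) = posP y k + 3 := by
  simp [posP, h]

theorem posP_lt_succ (y : ℕ → ℕ) (k : ℕ) : posP y k < posP y (k + 1) := by
  simp only [posP]; split_ifs <;> omega

theorem posP_strictMono (y : ℕ → ℕ) : StrictMono (posP y) := strictMono_nat_of_lt_succ (posP_lt_succ y)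

theorem le_posP (y : ℕ → ℕ) (k : ℕ) : k ≤ posP y k := (posP_strictMono y).le_apply

theorem posP_le (y : ℕ → ℕ) (k : ℕ) : posP y k ≤ 3 * k := by
  induction k with
  | zero => simp [posP]
  | succ k ih => simp only [posP]; split_ifs <;> omega

theorem posP_mod (y : ℕ → ℕ) (k : ℕ) : posP y k % 2 = k % 2 := by
  induction k with
  | zero => simp [posP]
  | succ k ih => simp only [posP]; split_ifs <;> omega

theorem posP_congr {y y' : ℕ → ℕ} (m : ℕ) (h : ∀ i < m, y i = y' i) : posP y m = posP y' m := by
  induction m with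
  | zero => rfl
  | succ m ih =>
    simp only [posP]
    rw [ih (fun i hi => h i (by omega)), h m (by omega)]

theorem posP_add (y : ℕ → ℕ) (k j : ℕ) : posP y (k + j) = posP y k + posP (shiftSeq y k) j := by
  induction j with
  | zero => simp [posP]
  | succ j ih =>
    rw [← add_assoc]
    have e : posP (shiftSeq y k) (j + 1)
        = posP (shiftSeq y k) j + (if y (k + j) = 0 then 1 else 3) := rfl
    have e' : posP y (k + j + 1) = posP y (k + j) + (if y (k + j) = 0 then 1 else 3) := rfl
    rw [e, e', ih, add_assoc]

theorem RelP_shift {y x : ℕ → ℕ} (h : RelP y x) (k : ℕ) :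
    RelP (shiftSeq y k) (shiftSeq x (posP y k)) := by
  intro j
  have := h (k + j)
  rw [posP_add] at this
  simpa [shiftSeq, add_assoc] using this

/-- Agreement of preimages gives agreement of images. -/
theorem RelP_agree {y y' x x' : ℕ → ℕ} (h : RelP y x) (h' : RelP y' x') (m : ℕ)
    (hm : ∀ i < m, y i = y' i) : ∀ i < posP y m, x i = x' i := by
  induction m with
  | zero => simp [posP]
  | succ m ih =>
    have ih := ih (fun i hi => hm i (by omega))
    have hP := posP_congr m (fun i hi => hm i (by omega : i < m + 1))
    obtain ⟨a, b⟩ := h m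
    obtain ⟨a', b'⟩ := h' m
    rw [← hP] at a' b'
    intro i hi
    by_cases h0 : y m = 0
    · rw [posP_succ_zero h0] at hi
      rcases Nat.lt_or_ge i (posP y m) with h1 | h1
      · exact ih i h1
      · have : i = posP y m := by omega
        rw [this, a, a']
    · rw [posP_succ_ne h0] at hi
      have b := b h0
      have b' := b' (by rw [← hm m (by omega)]; exact h0)
      rcases Nat.lt_or_ge i (posP y m) with h1 | h1
      · exact ih i h1
      · have : i = posP y m ∨ i = posP y m + 1 ∨ i = posP y m + 2 := by omega
        rcases this with rfl | rfl | rfl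
        · rw [a, a']
        · rw [b.1, b'.1]
        · rw [b.2, b'.2]

theorem RelP_unique {y x x' : ℕ → ℕ} (h : RelP y x) (h' : RelP y x') : x = x' := by
  funext i
  exact RelP_agree h h' (i + 1) (fun _ _ => rfl) i (by have := le_posP y (i + 1); omega)

theorem RelP_lt {y y' x x' : ℕ → ℕ} (h : RelP y x) (h' : RelP y' x')
    (hy : ∀ i, y i ≤ 1) (hy' : ∀ i, y' i ≤ 1) (hlt : altLt y y') : altLt x x' := by
  obtain ⟨k, hk, hk'⟩ := hlt
  have hag := RelP_agree h h' k hk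
  have hP := posP_congr k hk
  have hmod := posP_mod y k
  obtain ⟨a, b⟩ := h k
  obtain ⟨a', b'⟩ := h' k
  rw [← hP] at a' b'
  have c := (h (k + 1)).1
  have c' := (h' (k + 1)).1
  have := hy k
  have := hy' k
  refine ⟨posP y k + 1, ?_, ?_⟩
  · intro i hi
    rcases Nat.lt_or_ge i (posP y k) with h1 | h1
    · exact hag i h1
    · have : i = posP y k := by omega
      rw [this, a, a']
  · by_cases he : Even k
    · rw [if_pos he] at hk'
      rw [posP_succ_zero (by omega), ← hP] at c'
      have : ¬ Even (posP y k + 1) := by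
        rw [Nat.even_iff] at he ⊢; omega
      rw [if_neg this, c', (b (by omega)).1]; omega
    · rw [if_neg he] at hk'
      rw [posP_succ_zero (by omega)] at c
      have : Even (posP y k + 1) := by
        rw [Nat.even_iff] at he ⊢; omega
      rw [if_pos this, c, (b' (by omega)).1]; omega

theorem RelP_le {y y' x x' : ℕ → ℕ} (h : RelP y x) (h' : RelP y' x')
    (hy : ∀ i, y i ≤ 1) (hy' : ∀ i, y' i ≤ 1) (hlt : altLe y y') : altLe x x' := by
  rcases hlt with rfl | hlt
  · exact Or.inl (RelP_unique h h')
  · exact Or.inr (RelP_lt h h' hy hy' hlt)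

theorem RelP_le_rev {y y' x x' : ℕ → ℕ} (h : RelP y x) (h' : RelP y' x')
    (hy : ∀ i, y i ≤ 1) (hy' : ∀ i, y' i ≤ 1) (hlt : altLe x x') : altLe y y' := by
  apply altLe_of_not
  intro hc
  exact not_altLt_of_le hlt (RelP_lt h' h hy' hy hc)

open Classical in
/-- The image of `y` under the substitution. -/
noncomputable def phiS (y : ℕ → ℕ) : ℕ → ℕ := fun m => if ∃ k, posP y k = m then 1 else 0

theorem phiS_rel (y : ℕ → ℕ) : RelP y (phiS y) := by
  intro k
  refine ⟨by simp [phiS], fun h0 => ?_⟩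
  have key : ∀ j, posP y k < j → j < posP y (k + 1) → phiS y j = 0 := by
    intro j h1 h2
    unfold phiS
    rw [if_neg]
    rintro ⟨l, rfl⟩
    have a := (posP_strictMono y).lt_iff_lt.1 h1
    have b := (posP_strictMono y).lt_iff_lt.1 h2
    omega
  have := posP_succ_ne h0
  exact ⟨key _ (by omega) (by omega), key _ (by omega) (by omega)⟩

theorem phiS_le (y : ℕ → ℕ) (m : ℕ) : phiS y m ≤ 1 := by
  unfold phiS; split_ifs <;> omega

theorem phiS_one {y : ℕ → ℕ} {m : ℕ} (h : phiS y m ≠ 0) : ∃ k, posP y k = m := by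
  by_contra hc
  exact h (by unfold phiS; rw [if_neg hc])

/-- Decoding. -/
theorem decode (x : ℕ → ℕ) (hx : x 0 = 1)
    (hg : ∀ k, x k = 1 → x (k + 1) = 1 ∨ (x (k + 1) = 0 ∧ x (k + 2) = 0 ∧ x (k + 3) = 1)) :
    ∃ y : ℕ → ℕ, (∀ i, y i ≤ 1) ∧ RelP y x := by
  let p : ℕ → ℕ := fun k => Nat.rec 0 (fun _ q => q + (if x (q + 1) = 1 then 1 else 3)) k
  have p0 : p 0 = 0 := rfl
  have ps : ∀ k, p (k + 1) = p k + (if x (p k + 1) = 1 then 1 else 3) := fun _ => rfl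
  let y : ℕ → ℕ := fun k => if x (p k + 1) = 1 then 0 else 1
  have hyp : ∀ k, posP y k = p k := by
    intro k
    induction k with
    | zero => rfl
    | succ k ih =>
      rw [ps]
      simp only [posP, ih, y]
      split_ifs <;> simp_all
  have h1 : ∀ k, x (p k) = 1 := by
    intro k
    induction k with
    | zero => exact hx
    | succ k ih =>
      rw [ps]
      rcases hg _ ih with h | ⟨h, _, h'⟩
      · simp [h]
      · simp [h, h']
  refine ⟨y, fun i => by simp only [y]; split_ifs <;> omega, fun k => ?_⟩
  rw [hyp]
  refine ⟨h1 k, fun h0 => ?_⟩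
  have h2 : x (p k + 1) ≠ 1 := by
    intro hc
    simp [y, hc] at h0
  rcases hg _ (h1 k) with h | ⟨h, h', _⟩
  · exact absurd h h2
  · exact ⟨h, h'⟩

theorem good_of_le {d s : ℕ → ℕ} (h0 : d 0 = 1) (h1 : d 1 = 0) (h2 : d 2 = 0) (h3 : d 3 = 1)
    (hs : ∀ i, s i ≤ 1) (hs0 : s 0 = 1) (hle : altLe d s) :
    s 1 = 1 ∨ (s 1 = 0 ∧ s 2 = 0 ∧ s 3 = 1) := by
  have a1 := hs 1
  have a2 := hs 2
  have a3 := hs 3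
  rcases hle with rfl | ⟨k, hk, hk'⟩
  · omega
  · have b1 := hk 1
    have b2 := hk 2
    have b3 := hk 3
    rcases k with _ | _ | _ | _ | k
    · simp at hk'; omega
    · simp at hk'; omega
    · simp at hk'; omega
    · have : ¬ Even 3 := by decide
      simp [this] at hk'
      omega
    · omega

/-- Decoding of sequences all of whose shifts dominate a word starting with `1001`. -/
theorem decode_of_le {d x : ℕ → ℕ} (h0 : d 0 = 1) (h1 : d 1 = 0) (h2 : d 2 = 0) (h3 : d 3 = 1)
    (hs : ∀ i, x i ≤ 1) (hs0 : x 0 = 1) (hle : ∀ k, altLe d (shiftSeq x k)) :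
    ∃ y : ℕ → ℕ, (∀ i, y i ≤ 1) ∧ RelP y x := by
  apply decode x hs0
  intro k hk
  exact good_of_le h0 h1 h2 h3 (fun i => hs _) (by simpa [shiftSeq] using hk) (hle k)

/-! ### The fixed point -/

theorem phiW_append (u v : List ℕ) : phiW (u ++ v) = phiW u ++ phiW v := by
  simp [phiW]

theorem uW_succ (n : ℕ) : uW (n + 1) = phiW (uW n) := by
  simp only [uW, Function.iterate_succ_apply']

theorem uW_prefix (n : ℕ) : uW n <+: uW (n + 1) := by
  induction n with
  | zero => exact ⟨[0, 0], by simp [uW, phiW, phiL]⟩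
  | succ n ih =>
    obtain ⟨t, ht⟩ := ih
    refine ⟨phiW t, ?_⟩
    rw [uW_succ (n + 1), uW_succ n, ← phiW_append, ht, uW_succ n]

theorem uW_prefix_le {m n : ℕ} (h : m ≤ n) : uW m <+: uW n := by
  induction n, h using Nat.le_induction with
  | base => exact List.prefix_refl _
  | succ n _ ih => exact ih.trans (uW_prefix n)

theorem phiW_length_le (w : List ℕ) : w.length ≤ (phiW w).length := by
  induction w with
  | nil => simp [phiW]
  | cons a t ih =>
    have : phiW (a :: t) = phiL a ++ phiW t := by simp [phiW]
    rw [this, List.length_append, List.length_cons]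
    have : 1 ≤ (phiL a).length := by unfold phiL; split_ifs <;> simp
    omega

theorem uW_length (n : ℕ) : n + 1 ≤ (uW n).length := by
  induction n with
  | zero => simp [uW]
  | succ n ih =>
    obtain ⟨t, ht⟩ := uW_prefix_le (Nat.zero_le n)
    have h0 : uW 0 = [1] := rfl
    rw [uW_succ, ← ht, phiW_append, h0]
    rw [← ht, h0] at ih
    have := phiW_length_le t
    have h1 : (phiW [1]).length = 3 := by simp [phiW, phiL]
    simp only [List.length_append, h1] at ih ⊢
    simp at ih
    omega

theorem phiInf_eq {n i : ℕ} (h : i < (uW n).length) : phiInf i = (uW n)[i] := by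
  have hl : i < (uW (i + 1)).length := by have := uW_length (i + 1); omega
  have e : phiInf i = (uW (i + 1))[i] := by simp [phiInf, hl]
  rw [e]
  rcases le_total n (i + 1) with h1 | h1
  · exact ((uW_prefix_le h1).getElem h).symm
  · exact (uW_prefix_le h1).getElem hl

theorem phiW_take_length {w : List ℕ} {y : ℕ → ℕ} (h : ∀ i (hi : i < w.length), y i = w[i])
    (k : ℕ) (hk : k ≤ w.length) : (phiW (w.take k)).length = posP y k := by
  induction k with
  | zero => simp [phiW, posP]
  | succ k ih =>
    rw [List.take_add_one, phiW_append, List.length_append, ih (by omega)]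
    have hk' : k < w.length := by omega
    rw [List.getElem?_eq_getElem hk', ← h k hk']
    simp only [posP, Option.toList, phiW, List.flatMap_cons, List.flatMap_nil, List.append_nil, phiL]
    split_ifs <;> simp

theorem phiW_decomp (w : List ℕ) (k : ℕ) (hk : k < w.length) :
    phiW w = phiW (w.take k) ++ (phiL w[k] ++ phiW (w.drop (k + 1))) := by
  conv_lhs => rw [← List.take_append_drop k w]
  rw [phiW_append, List.drop_eq_getElem_cons hk]
  simp only [phiW, List.flatMap_cons]

theorem phiInf_rel : RelP phiInf phiInf := by
  intro k
  have hk : k < (uW k).length := by have := uW_length k; omega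
  have hy : ∀ i (hi : i < (uW k).length), phiInf i = (uW k)[i] := fun i hi => phiInf_eq hi
  have hd := phiW_decomp (uW k) k hk
  rw [← uW_succ, ← hy k hk] at hd
  have hlen := phiW_take_length hy k hk.le
  have key : ∀ j, j < (phiL (phiInf k)).length →
      phiInf (posP phiInf k + j) = (phiL (phiInf k)).getD j 0 := by
    intro j hj
    have hl : posP phiInf k + j < (uW (k + 1)).length := by
      rw [hd, List.length_append, List.length_append, hlen]; omega
    rw [phiInf_eq hl]
    have : (uW (k + 1))[posP phiInf k + j]? = (phiL (phiInf k))[j]? := by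
      rw [hd, List.getElem?_append_right (by omega), hlen, Nat.add_sub_cancel_left,
        List.getElem?_append_left hj]
    rw [List.getElem?_eq_getElem hl, List.getElem?_eq_getElem hj] at this
    simp only [Option.some.injEq] at this
    rw [this]
    simp [hj]
  by_cases h0 : phiInf k = 0
  · refine ⟨?_, fun h => absurd h0 h⟩
    have := key 0 (by simp [phiL, h0])
    simpa [phiL, h0] using this
  · have a := key 0 (by simp [phiL, h0])
    have b := key 1 (by simp [phiL, h0])
    have c := key 2 (by simp [phiL, h0])
    simp [phiL, h0] at a b c
    exact ⟨a, fun _ => ⟨b, c⟩⟩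

theorem phiInf_eq_phiS : phiInf = phiS phiInf := RelP_unique phiInf_rel (phiS_rel _)

theorem phiInf_le (i : ℕ) : phiInf i ≤ 1 := by
  rw [phiInf_eq_phiS]; exact phiS_le _ _

theorem phiInf_vals : phiInf 0 = 1 ∧ phiInf 1 = 0 ∧ phiInf 2 = 0 ∧ phiInf 3 = 1 := by
  have h0 := (phiInf_rel 0).1
  simp only [posP] at h0
  have h1 := (phiInf_rel 0).2 (by omega)
  have h2 := (phiInf_rel 1).1
  rw [posP_succ_ne (by omega)] at h2
  simp only [posP] at h1 h2
  exact ⟨h0, h1.1, h1.2, h2⟩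

/-! ### Counting prefixes -/

/-- Prefix of length `n`. -/
def pref (n : ℕ) (x : ℕ → ℕ) : List ℕ := (List.range n).map x

theorem pref_eq {n : ℕ} {x y : ℕ → ℕ} : pref n x = pref n y ↔ ∀ i < n, x i = y i := by
  simp [pref, List.map_inj_left]

theorem Lyndon_shift {d x : ℕ → ℕ} (h : x ∈ LyndonSystem d) (k : ℕ) :
    shiftSeq x k ∈ LyndonSystem d := by
  refine ⟨fun i => h.1 _, fun j => ?_⟩
  have := h.2 (k + j)
  have e : shiftSeq (shiftSeq x k) j = shiftSeq x (k + j) := by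
    funext i; simp [shiftSeq, add_assoc]
  rwa [e]

theorem Hword_eq (d : ℕ → ℕ) (n : ℕ) : Hword d n = (pref n '' LyndonSystem d).ncard := by
  unfold Hword
  congr 1
  ext w
  constructor
  · rintro ⟨⟨x, hx, k, hk⟩, rfl⟩
    exact ⟨shiftSeq x k, Lyndon_shift hx k, hk.symm⟩
  · rintro ⟨x, hx, rfl⟩
    have hl : (pref n x).length = n := by simp [pref]
    refine ⟨⟨x, hx, 0, ?_⟩, hl⟩
    rw [hl]; simp [pref]

theorem pref_finite (b n : ℕ) (S : Set (ℕ → ℕ)) (hS : ∀ x ∈ S, ∀ i, x i ≤ b) :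
    (pref n '' S).Finite := by
  apply (Set.finite_range (fun f : Fin n → Fin (b + 1) => List.ofFn (fun i => (f i : ℕ)))).subset
  rintro _ ⟨x, hx, rfl⟩
  refine ⟨fun i => ⟨x i, by have := hS x hx i; omega⟩, ?_⟩
  apply List.ext_getElem <;> simp [pref]

theorem Lyndon_finite (d : ℕ → ℕ) (n : ℕ) : (pref n '' LyndonSystem d).Finite :=
  pref_finite (d 0) n _ (fun x hx => hx.1)

/-- The full binary shift. -/
def Bin : Set (ℕ → ℕ) := {x | ∀ i, x i ≤ 1}

theorem Bin_count (n : ℕ) : 2 ^ n ≤ (pref n '' Bin).ncard := by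
  have h1 : (Set.univ : Set (Fin n → Fin 2)).ncard = 2 ^ n := by
    rw [Set.ncard_univ, Nat.card_eq_fintype_card]; simp
  rw [← h1]
  refine Set.ncard_le_ncard_of_injOn
    (fun b => pref n (fun i => if h : i < n then (b ⟨i, h⟩ : ℕ) else 0)) ?_ ?_
    (pref_finite 1 n _ (fun x hx => hx))
  · intro b _
    refine ⟨_, ?_, rfl⟩
    intro i
    dsimp only
    split_ifs
    · have := (b ⟨i, by assumption⟩).2
      omega
    · omega
  · intro b _ b' _ h
    have h := pref_eq.1 h
    funext i
    have := h i i.2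
    simp only [i.2, dif_pos] at this
    exact Fin.ext this

theorem phiS_inj {y y' : ℕ → ℕ} (hy : ∀ i, y i ≤ 1) (hy' : ∀ i, y' i ≤ 1) (n : ℕ)
    (h : ∀ i < 3 * n, phiS y i = phiS y' i) : ∀ i < n, y i = y' i := by
  intro k
  induction k using Nat.strong_induction_on with
  | _ k ih =>
    intro hk
    have ih' : ∀ i < k, y i = y' i := fun i hi => ih i hi (by omega)
    have hP := posP_congr k ih'
    have hb := posP_le y k
    have e := h (posP y k + 1) (by omega)
    have a := phiS_rel y
    have a' := phiS_rel y'
    have := hy k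
    have := hy' k
    by_cases h0 : y k = 0 <;> by_cases h0' : y' k = 0
    · omega
    · have u := (a (k + 1)).1
      rw [posP_succ_zero h0] at u
      have v := ((a' k).2 h0').1
      rw [← hP] at v
      omega
    · have u := (a' (k + 1)).1
      rw [posP_succ_zero h0', ← hP] at u
      have v := ((a k).2 h0).1
      omega
    · omega

theorem count_step (d : ℕ → ℕ) (S : Set (ℕ → ℕ)) (hS : ∀ y ∈ S, ∀ i, y i ≤ 1)
    (hT : ∀ y ∈ S, phiS y ∈ LyndonSystem d) (n : ℕ) :
    (pref n '' S).ncard ≤ Hword d (3 * n) := by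
  classical
  rw [Hword_eq]
  have hch : ∀ w : List ℕ, ∃ y : ℕ → ℕ, w ∈ pref n '' S → y ∈ S ∧ pref n y = w := by
    intro w
    by_cases hw : w ∈ pref n '' S
    · obtain ⟨y, hy, e⟩ := hw
      exact ⟨y, fun _ => ⟨hy, e⟩⟩
    · exact ⟨fun _ => 0, fun h => absurd h hw⟩
  choose g hg using hch
  refine Set.ncard_le_ncard_of_injOn (fun w => pref (3 * n) (phiS (g w))) ?_ ?_
    (Lyndon_finite d (3 * n))
  · intro w hw
    exact ⟨_, hT _ (hg w hw).1, rfl⟩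
  · intro w hw w' hw' h
    have h := pref_eq.1 h
    have := phiS_inj (hS _ (hg w hw).1) (hS _ (hg w' hw').1) n h
    rw [← (hg w hw).2, ← (hg w' hw').2]
    exact pref_eq.2 this

/-! ### Lower bound -/

theorem mem_of_blocks {d y : ℕ → ℕ} (hd : d 0 = 1)
    (h : ∀ k, altLe d (shiftSeq (phiS y) (posP y k))) : phiS y ∈ LyndonSystem d := by
  refine ⟨fun i => by rw [hd]; exact phiS_le y i, fun m => ?_⟩
  by_cases h0 : phiS y m = 0
  · right
    refine ⟨0, by simp, ?_⟩
    simp [shiftSeq, h0, hd]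
  · obtain ⟨k, rfl⟩ := phiS_one h0
    exact h k

theorem lyndon_le {d : ℕ → ℕ} (hd : IsAltLyndon d) (i : ℕ) : d i ≤ d 0 := by
  simpa [shiftSeq] using altLe_zero (hd i)

theorem lower (k : ℕ) : ∀ d : ℕ → ℕ, IsAltLyndon d → (∀ i < k, d i = phiInf i) →
    (if Even k then phiInf k < d k else d k < phiInf k) →
    ∃ c, 0 < c ∧ ∀ n, 2 ^ n ≤ Hword d (c * n) := by
  induction k using Nat.strong_induction_on with
  | _ k ih =>
  intro d hd hk hk'
  have hlt : altLt d phiInf := ⟨k, hk, hk'⟩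
  have hle := lyndon_le hd
  obtain ⟨f0, f1, f2, f3⟩ := phiInf_vals
  have hd0 : 1 ≤ d 0 := by
    have := altLe_zero (Or.inr hlt); omega
  rcases Nat.lt_or_ge 1 (d 0) with h2 | h2
  · -- large alphabet
    refine ⟨1, one_pos, fun n => ?_⟩
    rw [one_mul, Hword_eq]
    refine (Bin_count n).trans (Set.ncard_le_ncard (Set.image_mono ?_) (Lyndon_finite d n))
    intro x hx
    refine ⟨fun i => (hx i).trans hd0, fun j => Or.inr ⟨0, by simp, ?_⟩⟩
    have := hx j
    simp [shiftSeq]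
    omega
  have e0 : d 0 = 1 := by omega
  rw [e0] at hle
  by_cases hc : d 1 = 0 ∧ d 2 = 0 ∧ d 3 = 1
  · -- renormalisation
    obtain ⟨c1, c2, c3⟩ := hc
    obtain ⟨e, he, hr⟩ := decode_of_le e0 c1 c2 c3 hle e0 hd
    have heL : IsAltLyndon e := fun j =>
      RelP_le_rev hr (RelP_shift hr j) he (fun i => he _) (hd _)
    have helt : altLt e phiInf := by
      rcases altLt_tri e phiInf with h | h | h
      · exfalso
        subst h
        have := RelP_unique hr phiInf_rel
        rw [this] at hlt
        exact altLt_irrefl hlt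
      · exact h
      · exact (altLt_asymm hlt (RelP_lt phiInf_rel hr phiInf_le he h)).elim
    obtain ⟨l, hl, hl'⟩ := helt
    have hlk : l < k := by
      by_contra hcon
      have h1 := RelP_agree hr phiInf_rel l hl
      have h3 := (phiInf_rel l).1
      rw [← posP_congr l hl] at h3
      have h4 := (hr l).1
      have h5 := le_posP e l
      have : d k = phiInf k := by
        rcases Nat.lt_or_ge k (posP e l) with h | h
        · exact h1 k h
        · have : k = posP e l := by omega
          rw [this, h3, h4]
      split_ifs at hk' <;> omega
    obtain ⟨c, hcpos, hc⟩ := ih l hlk e heL hl hl'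
    refine ⟨3 * c, by omega, fun n => (hc n).trans ?_⟩
    rw [Hword_eq, mul_assoc]
    have hbin : ∀ y ∈ LyndonSystem e, ∀ i, y i ≤ 1 := fun y hy i => (hy.1 i).trans (he 0)
    refine count_step d _ hbin (fun y hy => ?_) _
    refine mem_of_blocks e0 (fun j => ?_)
    exact RelP_le hr (RelP_shift (phiS_rel y) j) he (fun i => hbin y hy _) (hy.2 j)
  · -- base case
    have hb : d 1 = 0 ∧ (d 2 = 1 ∨ (d 2 = 0 ∧ d 3 = 0)) := by
      have a1 := hle 1
      have a2 := hle 2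
      have a3 := hle 3
      have b1 := hk 1
      have b2 := hk 2
      have b3 := hk 3
      rcases k with _ | _ | _ | _ | k
      · simp at hk'; omega
      · simp at hk'; omega
      · simp at hk'; omega
      · have : ¬ Even 3 := by decide
        simp [this] at hk'
        omega
      · omega
    refine ⟨3, by omega, fun n => (Bin_count n).trans ?_⟩
    refine count_step d Bin (fun y hy => hy) (fun y hy => ?_) n
    refine mem_of_blocks e0 (fun j => Or.inr ?_)
    have q := phiS_rel y j
    have q' := (phiS_rel y (j + 1)).1
    by_cases hy0 : y j = 0
    · rw [posP_succ_zero hy0] at q'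
      refine ⟨1, ?_, ?_⟩
      · intro i hi
        have : i = 0 := by omega
        subst this
        simp [shiftSeq, e0, q.1]
      · simp [shiftSeq, q', hb.1]
    · rw [posP_succ_ne hy0] at q'
      obtain ⟨q1, q2, q3⟩ := And.intro q.1 (q.2 hy0)
      rcases hb with ⟨b1, b2 | ⟨b2, b3⟩⟩
      · refine ⟨2, ?_, ?_⟩
        · intro i hi
          have : i = 0 ∨ i = 1 := by omega
          rcases this with rfl | rfl
          · simp [shiftSeq, e0, q1]
          · simp [shiftSeq, b1, q2]
        · simp [shiftSeq, b2, q3]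
      · refine ⟨3, ?_, ?_⟩
        · intro i hi
          have : i = 0 ∨ i = 1 ∨ i = 2 := by omega
          rcases this with rfl | rfl | rfl
          · simp [shiftSeq, e0, q1]
          · simp [shiftSeq, b1, q2]
          · simp [shiftSeq, b2, q3]
        · have : ¬ Even 3 := by decide
          simp [this, shiftSeq, b3, q']

theorem pos_of_lower (d : ℕ → ℕ) (E : ℝ) (hE : EntropyIs d E) (c : ℕ) (hc : 0 < c)
    (h : ∀ n, 2 ^ n ≤ Hword d (c * n)) : 0 < E := by
  have hc' : (0 : ℝ) < c := by exact_mod_cast hc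
  have hl2 : 0 < Real.log 2 := Real.log_pos (by norm_num)
  have ht : Tendsto (fun n : ℕ => c * n) atTop atTop :=
    tendsto_id.const_mul_atTop' hc
  have h1 := hE.comp ht
  have h2 : Real.log 2 / c ≤ E := by
    refine ge_of_tendsto h1 ?_
    filter_upwards [eventually_ge_atTop 1] with n hn
    have hn' : (0 : ℝ) < n := by exact_mod_cast hn
    have h3 : ((2 : ℝ) ^ n) ≤ (Hword d (c * n) : ℝ) := by exact_mod_cast h n
    have h4 := Real.log_le_log (by positivity) h3
    rw [Real.log_pow] at h4
    simp only [Function.comp]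
    push_cast
    rw [div_le_div_iff₀ hc' (by positivity)]
    nlinarith
  have : 0 < Real.log 2 / c := by positivity
  linarith

/-! ### Upper bound -/

/-- Prepend `j` zeros. -/
def padZ (j : ℕ) (x : ℕ → ℕ) : ℕ → ℕ := fun m => if m < j then 0 else x (m - j)

theorem structure_one {x : ℕ → ℕ} (hx : x ∈ LyndonSystem phiInf) (n : ℕ) :
    ∃ j ≤ n, ∃ y ∈ LyndonSystem phiInf, ∀ i < n, x i = padZ j (phiS y) i := by
  classical
  by_cases h : ∃ j, j < n ∧ x j ≠ 0
  · obtain ⟨hj, hxj⟩ := Nat.find_spec h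
    have hmin : ∀ i < Nat.find h, x i = 0 := by
      intro i hi
      by_contra hc
      exact Nat.find_min h hi ⟨by omega, hc⟩
    generalize Nat.find h = j at hj hxj hmin
    obtain ⟨f0, f1, f2, f3⟩ := phiInf_vals
    have hb : ∀ i, x i ≤ 1 := fun i => by have := hx.1 i; omega
    have hs := Lyndon_shift hx j
    obtain ⟨y, hy, hr⟩ := decode_of_le (x := shiftSeq x j) f0 f1 f2 f3 (fun i => hb _)
      (by have := hb j; simp [shiftSeq]; omega) hs.2
    refine ⟨j, hj.le, y, ⟨fun i => by rw [f0]; exact hy i, fun k => ?_⟩, ?_⟩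
    · exact RelP_le_rev phiInf_rel (RelP_shift hr k) phiInf_le (fun i => hy _) (hs.2 _)
    · intro i _
      rw [← RelP_unique hr (phiS_rel y)]
      unfold padZ
      split_ifs with hi
      · exact hmin i hi
      · simp only [shiftSeq]
        congr 1
        omega
  · push Not at h
    refine ⟨n, le_rfl, x, hx, fun i hi => ?_⟩
    simp [padZ, hi, h i hi]

theorem posP_pad (i : ℕ) (u : ℕ → ℕ) (k : ℕ) : posP u k ≤ posP (padZ i u) (i + k) := by
  rw [posP_add]
  have : shiftSeq (padZ i u) i = u := by
    funext m; simp [shiftSeq, padZ]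
  rw [this]; omega

theorem posP_two (z : ℕ → ℕ) (m : ℕ) : 3 * m ≤ posP (phiS z) (posP z m) := by
  induction m with
  | zero => simp
  | succ m ih =>
    obtain ⟨a, b⟩ := phiS_rel z m
    have h1 := posP_succ_ne (y := phiS z) (k := posP z m) (by omega)
    by_cases h0 : z m = 0
    · rw [posP_succ_zero h0]; omega
    · rw [posP_succ_ne h0]
      have h2 := posP_lt_succ (phiS z) (posP z m + 1)
      have h3 := posP_lt_succ (phiS z) (posP z m + 2)
      simp only [add_assoc, Nat.reduceAdd] at h1 h2 h3
      omega

/-- Two-step coding map. -/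
noncomputable def cod (j i : ℕ) (z : ℕ → ℕ) : ℕ → ℕ := padZ j (phiS (padZ i (phiS z)))

theorem padZ_agree {n : ℕ} {x x' : ℕ → ℕ} (j : ℕ) (h : ∀ i < n, x i = x' i) :
    ∀ i < j + n, padZ j x i = padZ j x' i := by
  intro i hi
  unfold padZ
  split_ifs
  · rfl
  · exact h _ (by omega)

theorem cod_agree {z z' : ℕ → ℕ} (j i m : ℕ) (h : ∀ l < m, z l = z' l) :
    ∀ l < 3 * m, cod j i z l = cod j i z' l := by
  have h1 := RelP_agree (phiS_rel z) (phiS_rel z') m h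
  have h2 := padZ_agree i h1
  have h3 := RelP_agree (phiS_rel _) (phiS_rel _) _ h2
  have h4 := padZ_agree j h3
  intro l hl
  refine h4 l ?_
  have := posP_pad i (phiS z) (posP z m)
  have := posP_two z m
  omega

theorem structure_two {x : ℕ → ℕ} (hx : x ∈ LyndonSystem phiInf) (n : ℕ) :
    ∃ j ≤ n, ∃ i ≤ n, ∃ z ∈ LyndonSystem phiInf, ∀ l < n, x l = cod j i z l := by
  obtain ⟨j, hj, y, hy, h1⟩ := structure_one hx n
  obtain ⟨i, hi, z, hz, h2⟩ := structure_one hy n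
  refine ⟨j, hj, i, hi, z, hz, fun l hl => ?_⟩
  rw [h1 l hl]
  have h3 := RelP_agree (phiS_rel _) (phiS_rel _) n h2
  refine padZ_agree j h3 l ?_
  have := le_posP y n
  omega

theorem Hphi_rec (n : ℕ) : Hword phiInf n ≤ (n + 1) ^ 2 * Hword phiInf (n / 3 + 1) := by
  rw [Hword_eq, Hword_eq]
  set m := n / 3 + 1 with hm
  set S := pref m '' LyndonSystem phiInf with hS
  let T : Set ((ℕ × ℕ) × List ℕ) :=
    ((↑(Finset.range (n + 1)) : Set ℕ) ×ˢ (↑(Finset.range (n + 1)) : Set ℕ)) ×ˢ S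
  have hSf : S.Finite := Lyndon_finite _ _
  have hTf : T.Finite :=
    ((Finset.finite_toSet _).prod (Finset.finite_toSet _)).prod hSf
  have hTc : T.ncard = (n + 1) ^ 2 * S.ncard := by
    simp only [T]
    rw [Set.ncard_prod, Set.ncard_prod, Set.ncard_coe_finset, Finset.card_range, sq]
  rw [← hTc]
  let F : (ℕ × ℕ) × List ℕ → List ℕ := fun t => pref n (cod t.1.1 t.1.2 (fun i => t.2.getD i 0))
  refine (Set.ncard_le_ncard ?_ (hTf.image F)).trans (Set.ncard_image_le hTf)
  rintro _ ⟨x, hx, rfl⟩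
  obtain ⟨j, hj, i, hi, z, hz, h⟩ := structure_two hx n
  refine ⟨((j, i), pref m z), ⟨⟨?_, ?_⟩, ⟨z, hz, rfl⟩⟩, ?_⟩
  · simp; omega
  · simp; omega
  · simp only [F]
    rw [pref_eq]
    intro l hl
    rw [h l hl]
    refine cod_agree j i m ?_ l (by omega)
    intro q hq
    simp [pref, hq]

theorem Hphi_bound (ε : ℝ) (hε : 0 < ε) :
    ∃ K : ℝ, 1 ≤ K ∧ ∀ n : ℕ, (Hword phiInf n : ℝ) ≤ K * Real.exp (ε * n) := by
  have hlim : ∀ᶠ n : ℕ in atTop, ((n : ℝ) + 1) ^ 2 ≤ Real.exp (ε / 3 * n) := by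
    have h1 : Tendsto (fun n : ℕ => ε / 3 * (n : ℝ)) atTop atTop :=
      tendsto_natCast_atTop_atTop.const_mul_atTop (by positivity)
    filter_upwards [h1.eventually_ge_atTop (24 * (6 / ε) ^ 2 * 1 + 1), eventually_ge_atTop 1,
      tendsto_natCast_atTop_atTop.eventually_ge_atTop (24 * (3 / ε) ^ 3)] with n _ hn hb
    have hn' : (1 : ℝ) ≤ n := by exact_mod_cast hn
    have h3 := Real.pow_div_factorial_le_exp (ε / 3 * n) (by positivity) 3
    refine le_trans ?_ h3
    have : (Nat.factorial 3 : ℝ) = 6 := by norm_num [Nat.factorial]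
    rw [this]
    have h4 : 24 ≤ (ε / 3) ^ 3 * n := by
      have := mul_le_mul_of_nonneg_left hb (by positivity : 0 ≤ (ε / 3) ^ 3)
      have e : (ε / 3) ^ 3 * (24 * (3 / ε) ^ 3) = 24 := by field_simp
      linarith
    have h5 : 24 * (n : ℝ) ^ 2 ≤ (ε / 3 * n) ^ 3 := by
      have := mul_le_mul_of_nonneg_right h4 (by positivity : (0 : ℝ) ≤ (n : ℝ) ^ 2)
      calc 24 * (n : ℝ) ^ 2 ≤ _ := this
        _ = _ := by ring
    rw [le_div_iff₀ (by norm_num)]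
    nlinarith
  obtain ⟨N, hN⟩ := eventually_atTop.1 hlim
  refine ⟨∑ i ∈ Finset.range (N + 3), (Hword phiInf i : ℝ) + 1, ?_, ?_⟩
  · have : 0 ≤ ∑ i ∈ Finset.range (N + 3), (Hword phiInf i : ℝ) :=
      Finset.sum_nonneg (fun _ _ => Nat.cast_nonneg _)
    linarith
  set K := ∑ i ∈ Finset.range (N + 3), (Hword phiInf i : ℝ) + 1 with hK
  have hK0 : 0 ≤ K := by
    have : 0 ≤ ∑ i ∈ Finset.range (N + 3), (Hword phiInf i : ℝ) :=
      Finset.sum_nonneg (fun _ _ => Nat.cast_nonneg _)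
    linarith
  intro n
  induction n using Nat.strong_induction_on with
  | _ n ih =>
    rcases Nat.lt_or_ge n (N + 3) with h | h
    · have h1 : (Hword phiInf n : ℝ) ≤ ∑ i ∈ Finset.range (N + 3), (Hword phiInf i : ℝ) :=
        Finset.single_le_sum (f := fun i => (Hword phiInf i : ℝ))
          (fun _ _ => Nat.cast_nonneg _) (Finset.mem_range.2 h)
      have h2 : 1 ≤ Real.exp (ε * n) := Real.one_le_exp (by positivity)
      nlinarith
    · have h1 := ih (n / 3 + 1) (by omega)
      have h2 : (Hword phiInf n : ℝ) ≤ ((n : ℝ) + 1) ^ 2 * Hword phiInf (n / 3 + 1) := by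
        exact_mod_cast Hphi_rec n
      have h3 := hN n (by omega)
      have h4 : ((n / 3 + 1 : ℕ) : ℝ) ≤ 2 * n / 3 := by
        have : 3 * (n / 3 + 1) ≤ 2 * n := by omega
        have : (3 : ℝ) * ((n / 3 + 1 : ℕ) : ℝ) ≤ 2 * n := by exact_mod_cast this
        linarith
      calc (Hword phiInf n : ℝ) ≤ ((n : ℝ) + 1) ^ 2 * Hword phiInf (n / 3 + 1) := h2
        _ ≤ Real.exp (ε / 3 * n) * (K * Real.exp (ε * (2 * n / 3))) := by
          refine mul_le_mul h3 (h1.trans ?_) (Nat.cast_nonneg _) (Real.exp_pos _).le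
          refine mul_le_mul_of_nonneg_left (Real.exp_le_exp.2 ?_) hK0
          exact mul_le_mul_of_nonneg_left h4 hε.le
        _ = K * (Real.exp (ε / 3 * n) * Real.exp (ε * (2 * n / 3))) := by ring
        _ = K * Real.exp (ε * n) := by
          rw [← Real.exp_add]; congr 2; ring

theorem upper (d : ℕ → ℕ) (E : ℝ) (hE : EntropyIs d E) (h : altLe phiInf d) : E ≤ 0 := by
  have hd0 : d 0 ≤ 1 := by
    have := altLe_zero h
    have := phiInf_vals.1
    omega
  have hsub : LyndonSystem d ⊆ LyndonSystem phiInf := by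
    intro x hx
    refine ⟨fun i => by rw [phiInf_vals.1]; exact (hx.1 i).trans hd0, fun k => ?_⟩
    exact altLe_trans h (hx.2 k)
  have hH : ∀ n, Hword d n ≤ Hword phiInf n := fun n => by
    rw [Hword_eq, Hword_eq]
    exact Set.ncard_le_ncard (Set.image_mono hsub) (Lyndon_finite _ _)
  refine le_of_forall_pos_le_add (fun ε hε => ?_)
  rw [zero_add]
  obtain ⟨K, hK1, hK⟩ := Hphi_bound ε hε
  have ht : Tendsto (fun n : ℕ => Real.log K / (n : ℝ) + ε) atTop (𝓝 (0 + ε)) :=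
    (tendsto_const_div_atTop_nhds_zero_nat _).add tendsto_const_nhds
  rw [zero_add] at ht
  refine le_of_tendsto_of_tendsto hE ht ?_
  filter_upwards [eventually_ge_atTop 1] with n hn
  have hn' : (0 : ℝ) < n := by exact_mod_cast hn
  have hlog : Real.log (Hword d n) ≤ Real.log K + ε * n := by
    have hKl := Real.log_nonneg hK1
    rcases Nat.eq_zero_or_pos (Hword d n) with h0 | h0
    · rw [h0]
      simp only [Nat.cast_zero, Real.log_zero]
      positivity
    · have h1 : (Hword d n : ℝ) ≤ K * Real.exp (ε * n) :=
        le_trans (by exact_mod_cast hH n) (hK n)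
      have h2 := Real.log_le_log (by exact_mod_cast h0) h1
      rwa [Real.log_mul (by linarith) (Real.exp_pos _).ne', Real.log_exp] at h2
  rw [div_le_iff₀ hn', add_mul, div_mul_cancel₀ _ hn'.ne']
  exact hlog

/-- Theorem 1 (a) / Corollary 1: `M` has strictly positive entropy iff
`(d_i) ≺ φ^∞(1)` in the alternate order. -/
theorem stmt10 (d : ℕ → ℕ) (E : ℝ) (hd : IsAltLyndon d) (hE : EntropyIs d E) :
    0 < E ↔ altLt d phiInf := by
  constructor
  · intro hpos
    by_contra hc
    exact absurd (upper d E hE (altLe_of_not hc)) (not_le.2 hpos)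
  · rintro ⟨k, hk, hk'⟩
    obtain ⟨c, hc, h⟩ := lower k d hd hk hk'
    exact pos_of_lower d E hE c hc h
end

section
/- Let (d_i)_{i≥1} be an alternate Lyndon word, M the associated Lyndon system with language L_M, and log β > 0 its topological entropy. Suppose the finite word d_1 d_2 ⋯ d_{i−1} j belongs to L_M and (−1)^i (d_i − j) < 0. Then f_β(d_1 d_2 ⋯ d_{i−1} j) = Σ_{k=1}^{i−1} d_k/(−β)^k + j/(−β)^i ≥ −β/(β+1). -/
open Filter Topology

namespace AltAux

def pref (n : ℕ) (x : ℕ → ℕ) : List ℕ := (List.range n).map x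

def cons (a : ℕ) (y : ℕ → ℕ) : ℕ → ℕ
  | 0 => a
  | n + 1 => y n

def ltL : ℕ → List ℕ → List ℕ → Prop
  | 0, _, _ => False
  | n + 1, u, v => v.headD 0 < u.headD 0 ∨ (u.headD 0 = v.headD 0 ∧ ltL n v.tail u.tail)

theorem pref_succ (n : ℕ) (x : ℕ → ℕ) : pref (n + 1) x = x 0 :: pref n (shiftSeq x 1) := by
  simp only [pref, List.range_succ_eq_map, List.map_cons, List.map_map]
  congr 1
  apply List.map_congr_left
  intro a _
  simp [shiftSeq, add_comm]

theorem shift_shift (x : ℕ → ℕ) (a b : ℕ) : shiftSeq (shiftSeq x a) b = shiftSeq x (a + b) := by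
  funext i; simp [shiftSeq, add_assoc]

theorem shift_cons (a : ℕ) (y : ℕ → ℕ) : shiftSeq (cons a y) 1 = y := by
  funext i; simp [shiftSeq, add_comm, cons]

theorem cons_shift (x : ℕ → ℕ) : cons (x 0) (shiftSeq x 1) = x := by
  funext i; cases i <;> simp [shiftSeq, add_comm, cons]

theorem altLt_trans {x y z : ℕ → ℕ} (h1 : altLt x y) (h2 : altLt y z) : altLt x z := by
  obtain ⟨k, hk, hk'⟩ := h1
  obtain ⟨l, hl, hl'⟩ := h2
  rcases lt_trichotomy k l with h | h | h
  · refine ⟨k, fun i hi => (hk i hi).trans (hl i (hi.trans h)), ?_⟩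
    rw [← hl k h]; exact hk'
  · subst h
    refine ⟨k, fun i hi => (hk i hi).trans (hl i hi), ?_⟩
    split_ifs at * <;> omega
  · refine ⟨l, fun i hi => (hk i (hi.trans h)).trans (hl i hi), ?_⟩
    rw [hk l h]; exact hl'

theorem altLt_of_head {x y : ℕ → ℕ} (h : y 0 < x 0) : altLt x y :=
  ⟨0, by simp, by simpa using h⟩

theorem altLt_of_tail {x y : ℕ → ℕ} (h0 : x 0 = y 0)
    (h : altLt (shiftSeq y 1) (shiftSeq x 1)) : altLt x y := by
  obtain ⟨k, hk, hk'⟩ := h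
  refine ⟨k + 1, ?_, ?_⟩
  · intro i hi
    cases i with
    | zero => exact h0
    | succ i =>
      have := hk i (by omega)
      simp only [shiftSeq] at this
      rw [add_comm 1 i] at this
      exact this.symm
  · simp only [shiftSeq, add_comm 1 k] at hk'
    by_cases he : Even k
    · have : ¬ Even (k + 1) := by simpa [Nat.even_add_one] using he
      simpa [this, he] using hk'
    · have : Even (k + 1) := by simpa [Nat.even_add_one] using he
      simpa [this, he] using hk'

theorem altLt_of_ltL (n : ℕ) : ∀ (x y : ℕ → ℕ), ltL n (pref n x) (pref n y) → altLt x y := by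
  induction n with
  | zero => intro x y h; exact h.elim
  | succ n ih =>
    intro x y h
    rw [pref_succ, pref_succ] at h
    simp only [ltL, List.headD_cons, List.tail_cons] at h
    rcases h with h | ⟨h0, h⟩
    · exact altLt_of_head h
    · exact altLt_of_tail h0 (ih _ _ h)

theorem ltL_irrefl (n : ℕ) : ∀ u, ¬ ltL n u u := by
  induction n with
  | zero => intro u h; exact h
  | succ n ih =>
    intro u h
    simp only [ltL] at h
    rcases h with h | h
    · exact lt_irrefl _ h
    · exact ih _ h.2

theorem ltL_asymm (n : ℕ) : ∀ u v, ltL n u v → ¬ ltL n v u := by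
  induction n with
  | zero => intro u v h; exact h.elim
  | succ n ih =>
    intro u v h h'
    simp only [ltL] at h h'
    rcases h with h | h <;> rcases h' with h' | h'
    · omega
    · omega
    · omega
    · exact ih _ _ h.2 h'.2

theorem ltL_total (n : ℕ) : ∀ x y : ℕ → ℕ, ltL n (pref n x) (pref n y) ∨
    pref n x = pref n y ∨ ltL n (pref n y) (pref n x) := by
  induction n with
  | zero => intro x y; right; left; rfl
  | succ n ih =>
    intro x y
    rw [pref_succ, pref_succ]
    simp only [ltL, List.headD_cons, List.tail_cons]
    rcases lt_trichotomy (x 0) (y 0) with h | h | h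
    · tauto
    · rw [h]
      rcases ih (shiftSeq x 1) (shiftSeq y 1) with h | h | h
      · tauto
      · rw [h]; tauto
      · tauto
    · tauto

theorem shift_mem {d x : ℕ → ℕ} (hx : x ∈ LyndonSystem d) (k : ℕ) :
    shiftSeq x k ∈ LyndonSystem d := by
  refine ⟨fun i => hx.1 _, fun l => ?_⟩
  rw [shift_shift]; exact hx.2 _

theorem cons_mem {d x y : ℕ → ℕ} {a : ℕ} (hx : x ∈ LyndonSystem d) (hy : y ∈ LyndonSystem d)
    (ha : a ≤ x 0) (h : altLt x (cons a y)) : cons a y ∈ LyndonSystem d := by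
  refine ⟨?_, ?_⟩
  · intro i
    cases i with
    | zero => exact ha.trans (hx.1 0)
    | succ i => exact hy.1 i
  · intro k
    cases k with
    | zero =>
      have h0 : ∀ z, shiftSeq z 0 = z := fun z => by funext i; simp [shiftSeq]
      have := hx.2 0
      rw [h0] at this ⊢
      rcases this with h1 | h1
      · rw [h1]; exact Or.inr h
      · exact Or.inr (altLt_trans h1 h)
    | succ k =>
      rw [add_comm, ← shift_shift, shift_cons]
      exact hy.2 k

theorem self_mem {d : ℕ → ℕ} (hd : IsAltLyndon d) : d ∈ LyndonSystem d := by
  refine ⟨fun i => ?_, hd⟩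
  rcases hd i with h | ⟨k, hk, hk'⟩
  · have := congrFun h 0
    simp [shiftSeq] at this
    omega
  · rcases Nat.eq_zero_or_pos k with h0 | h0
    · subst h0
      simp [shiftSeq] at hk'
      omega
    · have := hk 0 h0
      simp [shiftSeq] at this
      omega

def Ln (d : ℕ → ℕ) (n : ℕ) : Set (List ℕ) := {w | ∃ x ∈ LyndonSystem d, w = pref n x}

theorem Hword_eq (d : ℕ → ℕ) (n : ℕ) : Hword d n = (Ln d n).ncard := by
  unfold Hword
  congr 1
  ext w
  constructor
  · rintro ⟨⟨x, hx, k, hk⟩, hl⟩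
    refine ⟨shiftSeq x k, shift_mem hx k, ?_⟩
    rw [hl] at hk
    exact hk
  · rintro ⟨x, hx, rfl⟩
    have hl : (pref n x).length = n := by simp [pref]
    refine ⟨⟨x, hx, 0, ?_⟩, hl⟩
    rw [hl]; simp [pref]

theorem Ln_finite (d : ℕ → ℕ) (n : ℕ) : (Ln d n).Finite := by
  induction n with
  | zero =>
    apply (Set.finite_singleton ([] : List ℕ)).subset
    rintro w ⟨x, _, rfl⟩
    simp [pref]
  | succ n ih =>
    apply ((Set.finite_Iic (d 0)).image2 List.cons ih).subset
    rintro w ⟨x, hx, rfl⟩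
    rw [pref_succ]
    exact ⟨x 0, hx.1 0, _, ⟨_, shift_mem hx 1, rfl⟩, rfl⟩

noncomputable def G (d : ℕ → ℕ) (n : ℕ) (x : ℕ → ℕ) : ℕ :=
  Set.ncard {w | w ∈ Ln d n ∧ ltL n (pref n x) w}

noncomputable def N (d : ℕ → ℕ) (n : ℕ) (x : ℕ → ℕ) : ℕ :=
  Set.ncard {w | w ∈ Ln d n ∧ ltL n w (pref n x)}

theorem GN (d : ℕ → ℕ) (n : ℕ) (x : ℕ → ℕ) (hx : x ∈ LyndonSystem d) :
    G d n x + N d n x + 1 = Hword d n := by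
  have hfin := Ln_finite d n
  have e : Ln d n = insert (pref n x) ({w | w ∈ Ln d n ∧ ltL n (pref n x) w} ∪
      {w | w ∈ Ln d n ∧ ltL n w (pref n x)}) := by
    ext w
    constructor
    · rintro ⟨y, hy, rfl⟩
      have hm : pref n y ∈ Ln d n := ⟨y, hy, rfl⟩
      rcases ltL_total n x y with h | h | h
      · right; left; exact ⟨hm, h⟩
      · left; exact h.symm
      · right; right; exact ⟨hm, h⟩
    · rintro (rfl | h | h)
      · exact ⟨x, hx, rfl⟩
      · exact h.1
      · exact h.1
  have f1 : {w | w ∈ Ln d n ∧ ltL n (pref n x) w}.Finite := hfin.subset fun w h => h.1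
  have f2 : {w | w ∈ Ln d n ∧ ltL n w (pref n x)}.Finite := hfin.subset fun w h => h.1
  rw [Hword_eq, e, Set.ncard_insert_of_notMem _ (f1.union f2), Set.ncard_union_eq _ f1 f2]
  · rfl
  · rw [Set.disjoint_left]
    rintro w h1 h2
    exact ltL_asymm _ _ _ h1.2 h2.2
  · rintro (h | h) <;> exact ltL_irrefl _ _ h.2

theorem G_succ (d : ℕ → ℕ) (n : ℕ) (x : ℕ → ℕ) (hx : x ∈ LyndonSystem d) :
    G d (n + 1) x = x 0 * Hword d n + N d n (shiftSeq x 1) := by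
  have hfin := Ln_finite d n
  have e : {w | w ∈ Ln d (n + 1) ∧ ltL (n + 1) (pref (n + 1) x) w} =
      (fun p : ℕ × List ℕ => p.1 :: p.2) '' (Set.Iio (x 0) ×ˢ Ln d n) ∪
      (List.cons (x 0)) '' {w | w ∈ Ln d n ∧ ltL n w (pref n (shiftSeq x 1))} := by
    ext w
    constructor
    · rintro ⟨⟨y, hy, rfl⟩, h⟩
      have hm : pref n (shiftSeq y 1) ∈ Ln d n := ⟨_, shift_mem hy 1, rfl⟩
      rw [pref_succ, pref_succ] at h
      simp only [ltL, List.headD_cons, List.tail_cons] at h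
      rw [pref_succ]
      rcases h with h | ⟨h0, h⟩
      · left; exact ⟨(y 0, _), ⟨h, hm⟩, rfl⟩
      · right; exact ⟨_, ⟨hm, h⟩, by rw [h0]⟩
    · have key : ∀ a y, y ∈ LyndonSystem d → a ≤ x 0 →
          ltL (n + 1) (pref (n + 1) x) (a :: pref n y) →
          a :: pref n y ∈ Ln d (n + 1) ∧ ltL (n + 1) (pref (n + 1) x) (a :: pref n y) := by
        intro a y hy ha h
        have e : a :: pref n y = pref (n + 1) (cons a y) := by
          rw [pref_succ, shift_cons]; rfl
        refine ⟨⟨cons a y, cons_mem hx hy ha ?_, e⟩, h⟩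
        rw [e] at h
        exact altLt_of_ltL _ _ _ h
      rintro (⟨⟨a, w⟩, ⟨ha, y, hy, rfl⟩, rfl⟩ | ⟨w, ⟨⟨y, hy, rfl⟩, h⟩, rfl⟩)
      · refine key a y hy (le_of_lt ha) ?_
        rw [pref_succ]
        simp only [ltL, List.headD_cons, List.tail_cons]
        left; exact ha
      · refine key (x 0) y hy le_rfl ?_
        rw [pref_succ]
        simp only [ltL, List.headD_cons, List.tail_cons]
        right; exact ⟨by trivial, h⟩
  have f2 : {w | w ∈ Ln d n ∧ ltL n w (pref n (shiftSeq x 1))}.Finite :=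
    hfin.subset fun w h => h.1
  unfold G
  rw [e, Set.ncard_union_eq _ (((Set.finite_Iio _).prod hfin).image _) (f2.image _),
    Set.ncard_image_of_injective, Set.ncard_image_of_injective, Set.ncard_prod, Hword_eq]
  · congr 2
    simp [Set.ncard_eq_toFinset_card']
  · exact List.cons_injective
  · rintro ⟨a, u⟩ ⟨b, v⟩ h
    simpa using h
  · rw [Set.disjoint_left]
    rintro w ⟨⟨a, u⟩, ⟨ha, _⟩, rfl⟩ ⟨v, _, hv⟩
    have : x 0 = a := by simpa using (List.cons.inj hv).1
    simp at ha
    omega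

theorem G_zero (d x : ℕ → ℕ) : G d 0 x = 0 := by
  simp [G, ltL]

theorem G_rec (d : ℕ → ℕ) (n : ℕ) (x : ℕ → ℕ) (hx : x ∈ LyndonSystem d) :
    (G d (n + 1) x : ℝ) = (x 0 + 1) * Hword d n - 1 - G d n (shiftSeq x 1) := by
  have h1 := G_succ d n x hx
  have h2 := GN d n _ (shift_mem hx 1)
  have h3 : (G d (n + 1) x : ℝ) = x 0 * Hword d n + N d n (shiftSeq x 1) := by exact_mod_cast h1
  have h4 : (G d n (shiftSeq x 1) : ℝ) + N d n (shiftSeq x 1) + 1 = Hword d n := by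
    exact_mod_cast h2
  rw [h3]; linear_combination h4

theorem G_le (d : ℕ → ℕ) (n : ℕ) (x : ℕ → ℕ) (hx : x ∈ LyndonSystem d) :
    G d n x ≤ Hword d n := by
  have := GN d n x hx
  omega

theorem H_pos {d : ℕ → ℕ} (hd : IsAltLyndon d) (n : ℕ) : 1 ≤ Hword d n := by
  have := GN d n d (self_mem hd)
  omega

theorem H_submul (d : ℕ → ℕ) (m n : ℕ) : Hword d (m + n) ≤ Hword d m * Hword d n := by
  rw [Hword_eq, Hword_eq, Hword_eq, ← Set.ncard_prod]
  have hf : (Ln d m ×ˢ Ln d n).Finite := (Ln_finite d m).prod (Ln_finite d n)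
  refine le_trans ?_ (Set.ncard_image_le (f := fun p : List ℕ × List ℕ => p.1 ++ p.2) hf)
  apply Set.ncard_le_ncard _ (hf.image _)
  rintro w ⟨x, hx, rfl⟩
  refine ⟨(pref m x, pref n (shiftSeq x m)), ⟨⟨x, hx, rfl⟩, ⟨_, shift_mem hx m, rfl⟩⟩, ?_⟩
  simp only [pref, List.range_add, List.map_append, List.map_map]
  rfl

theorem H_ge {d : ℕ → ℕ} (hd : IsAltLyndon d) {β : ℝ} (hβ : 1 < β)
    (hE : EntropyIs d (Real.log β)) (n : ℕ) : β ^ n ≤ Hword d n := by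
  have hp : ∀ n, (0 : ℝ) < Hword d n := fun n => by exact_mod_cast H_pos hd n
  have hp1 : ∀ n, (1 : ℝ) ≤ Hword d n := fun n => by exact_mod_cast H_pos hd n
  have hs : Subadditive (fun n => Real.log (Hword d n)) := by
    intro m n
    rw [← Real.log_mul (hp m).ne' (hp n).ne']
    apply Real.log_le_log (hp _)
    exact_mod_cast H_submul d m n
  have hb : BddBelow (Set.range fun n => Real.log (Hword d n) / n) := by
    refine ⟨0, ?_⟩
    rintro _ ⟨n, rfl⟩
    exact div_nonneg (Real.log_nonneg (hp1 n)) (Nat.cast_nonneg n)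
  have hl : hs.lim = Real.log β := tendsto_nhds_unique (hs.tendsto_lim hb) hE
  rcases Nat.eq_zero_or_pos n with h0 | h0
  · subst h0; simpa using hp1 0
  · have := hs.lim_le_div hb h0.ne'
    rw [hl, le_div_iff₀ (by exact_mod_cast h0)] at this
    rw [← Real.log_le_log_iff (by positivity) (hp n), Real.log_pow]
    linarith

theorem H_summable {d : ℕ → ℕ} (hd : IsAltLyndon d) {β : ℝ} (hβ : 1 < β)
    (hE : EntropyIs d (Real.log β)) {z : ℝ} (hz : 0 < z) (hz1 : β * z < 1) :
    Summable (fun n => (Hword d n : ℝ) * z ^ n) := by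
  have hp : ∀ n, (0 : ℝ) < Hword d n := fun n => by exact_mod_cast H_pos hd n
  obtain ⟨r, hr1, hr2⟩ : ∃ r, β < r ∧ r < 1 / z :=
    exists_between (by rw [lt_div_iff₀ hz]; exact hz1)
  have hr0 : 0 < r := by linarith
  have hrz : r * z < 1 := by rwa [lt_div_iff₀ hz] at hr2
  have hlog : Real.log β < Real.log r := Real.log_lt_log (by linarith) hr1
  have ev : ∀ᶠ n : ℕ in atTop, Real.log (Hword d n) / n < Real.log r :=
    hE.eventually (gt_mem_nhds hlog)
  refine Summable.of_norm_bounded_eventually_nat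
    (summable_geometric_of_lt_one (by positivity) hrz) ?_
  filter_upwards [ev, eventually_gt_atTop 0] with n hn hn0
  rw [Real.norm_of_nonneg (mul_nonneg (hp n).le (by positivity)), mul_pow]
  apply mul_le_mul_of_nonneg_right _ (by positivity)
  rw [div_lt_iff₀ (by exact_mod_cast hn0)] at hn
  rw [← Real.log_le_log_iff (hp n) (by positivity), Real.log_pow]
  linarith

noncomputable def hh (d : ℕ → ℕ) (z : ℝ) : ℝ := ∑' n, (Hword d n : ℝ) * z ^ n
noncomputable def gg (d : ℕ → ℕ) (z : ℝ) (x : ℕ → ℕ) : ℝ := ∑' n, (G d n x : ℝ) * z ^ n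

theorem G_summable {d : ℕ → ℕ} {z : ℝ} (hz : 0 < z)
    (hs : Summable (fun n => (Hword d n : ℝ) * z ^ n)) {x : ℕ → ℕ} (hx : x ∈ LyndonSystem d) :
    Summable (fun n => (G d n x : ℝ) * z ^ n) := by
  refine Summable.of_nonneg_of_le (fun n => by positivity) (fun n => ?_) hs
  apply mul_le_mul_of_nonneg_right _ (by positivity)
  exact_mod_cast G_le d n x hx

theorem gg_nonneg {d : ℕ → ℕ} {z : ℝ} (hz : 0 < z) (x : ℕ → ℕ) : 0 ≤ gg d z x :=
  tsum_nonneg fun n => by positivity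

theorem gg_le {d : ℕ → ℕ} {z : ℝ} (hz : 0 < z)
    (hs : Summable (fun n => (Hword d n : ℝ) * z ^ n)) {x : ℕ → ℕ} (hx : x ∈ LyndonSystem d) :
    gg d z x ≤ hh d z := by
  refine (G_summable hz hs hx).tsum_le_tsum (fun n => ?_) hs
  apply mul_le_mul_of_nonneg_right _ (by positivity)
  exact_mod_cast G_le d n x hx

theorem gg_rec {d : ℕ → ℕ} {z : ℝ} (hz : 0 < z) (hz1 : z < 1)
    (hs : Summable (fun n => (Hword d n : ℝ) * z ^ n)) {x : ℕ → ℕ} (hx : x ∈ LyndonSystem d) :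
    gg d z x = z * ((x 0 + 1) * hh d z - 1 / (1 - z) - gg d z (shiftSeq x 1)) := by
  have hg := hasSum_geometric_of_lt_one hz.le hz1
  have h1 := ((hs.hasSum.mul_left ((x 0 : ℝ) + 1)).sub hg).sub
    (G_summable hz hs (shift_mem hx 1)).hasSum
  have h2 := h1.mul_left z
  unfold gg hh
  rw [(G_summable hz hs hx).tsum_eq_zero_add, G_zero]
  simp only [Nat.cast_zero, zero_mul, zero_add]
  rw [one_div]
  convert h2.tsum_eq using 1
  apply tsum_congr
  intro n
  rw [G_rec d n x hx]
  ring

theorem gg_iter {d : ℕ → ℕ} {z : ℝ} (hz : 0 < z) (hz1 : z < 1)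
    (hs : Summable (fun n => (Hword d n : ℝ) * z ^ n)) {x : ℕ → ℕ} (hx : x ∈ LyndonSystem d)
    (i : ℕ) :
    gg d z x = hh d z * (∑ k ∈ Finset.range i, (-1) ^ k * z ^ (k + 1) * ((x k : ℝ) + 1))
      - 1 / (1 - z) * (∑ k ∈ Finset.range i, (-1) ^ k * z ^ (k + 1))
      + (-1) ^ i * z ^ i * gg d z (shiftSeq x i) := by
  induction i with
  | zero =>
    have h0 : shiftSeq x 0 = x := by funext i; simp [shiftSeq]
    simp [h0]
  | succ i ih =>
    have := gg_rec hz hz1 hs (shift_mem hx i)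
    rw [shift_shift] at this
    have e : shiftSeq x i 0 = x i := by simp [shiftSeq]
    rw [e] at this
    rw [ih, this, Finset.sum_range_succ, Finset.sum_range_succ]
    ring

theorem hh_ge {d : ℕ → ℕ} (hd : IsAltLyndon d) {β : ℝ} (hβ : 1 < β)
    (hE : EntropyIs d (Real.log β)) {z : ℝ} (hz : 0 < z) (hz1 : β * z < 1) :
    (1 - β * z)⁻¹ ≤ hh d z := by
  rw [← tsum_geometric_of_lt_one (by positivity) hz1]
  refine (summable_geometric_of_lt_one (by positivity) hz1).tsum_le_tsum (fun n => ?_)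
    (H_summable hd hβ hE hz hz1)
  rw [mul_pow]
  exact mul_le_mul_of_nonneg_right (H_ge hd hβ hE n) (by positivity)

theorem S_bound {d : ℕ → ℕ} (hd : IsAltLyndon d) {β : ℝ} (hβ : 1 < β)
    (hE : EntropyIs d (Real.log β)) (i : ℕ) {z : ℝ} (hz : 0 < z) (hz1 : β * z < 1) :
    ∑ k ∈ Finset.range i, (-1) ^ k * z ^ (k + 1) * ((d k : ℝ) + 1) ≤
      1 + (1 - (-1) ^ i) / 2 * z ^ i + (1 - β * z) * (1 / (1 - z) * i) := by
  have hz2 : z < 1 := by nlinarith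
  have hs := H_summable hd hβ hE hz hz1
  have hm := self_mem hd
  have h1 := gg_iter hz hz2 hs hm i
  have h2 := gg_le hz hs hm
  have h3 := gg_le hz hs (shift_mem hm i)
  have h4 := gg_nonneg (d := d) hz (shiftSeq d i)
  have h5 := hh_ge hd hβ hE hz hz1
  have hb : 0 < 1 - β * z := by linarith
  have h6 : 0 < hh d z := lt_of_lt_of_le (by positivity) h5
  have h7 : 1 ≤ (1 - β * z) * hh d z := by
    rwa [inv_le_iff_one_le_mul₀' hb] at h5
  have h8 : ∑ k ∈ Finset.range i, (-1 : ℝ) ^ k * z ^ (k + 1) ≤ i := by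
    calc _ ≤ ∑ k ∈ Finset.range i, (1 : ℝ) := by
          apply Finset.sum_le_sum
          intro k _
          have : z ^ (k + 1) ≤ 1 := pow_le_one₀ hz.le hz2.le
          have : 0 < z ^ (k + 1) := by positivity
          rcases neg_one_pow_eq_or ℝ k with h | h <;> rw [h] <;> linarith
      _ = i := by simp
  have h9 : -((1 - (-1) ^ i) / 2 * z ^ i * hh d z) ≤ (-1) ^ i * z ^ i * gg d z (shiftSeq d i) := by
    have hzi : 0 < z ^ i := by positivity
    rcases neg_one_pow_eq_or ℝ i with h | h <;> rw [h]
    · have : 0 ≤ z ^ i * gg d z (shiftSeq d i) := by positivity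
      linarith
    · have := mul_le_mul_of_nonneg_left h3 hzi.le
      linarith
  have hq : 0 < 1 / (1 - z) := by
    have : 0 < 1 - z := by linarith
    positivity
  have h10 : 1 / (1 - z) * (∑ k ∈ Finset.range i, (-1 : ℝ) ^ k * z ^ (k + 1)) ≤
      1 / (1 - z) * i := mul_le_mul_of_nonneg_left h8 hq.le
  have h11 : 1 / (1 - z) * (i : ℝ) ≤ (1 / (1 - z) * i) * ((1 - β * z) * hh d z) :=
    le_mul_of_one_le_right (by positivity) h7
  refine le_of_mul_le_mul_left ?_ h6
  linarith

theorem S_lim {d : ℕ → ℕ} (hd : IsAltLyndon d) {β : ℝ} (hβ : 1 < β)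
    (hE : EntropyIs d (Real.log β)) (i : ℕ) :
    ∑ k ∈ Finset.range i, (-1) ^ k * (β⁻¹) ^ (k + 1) * ((d k : ℝ) + 1) ≤
      1 + (1 - (-1) ^ i) / 2 * (β⁻¹) ^ i := by
  have hβ0 : 0 < β := by linarith
  have hne : (1 : ℝ) - β⁻¹ ≠ 0 := by
    have := inv_lt_one_of_one_lt₀ hβ
    linarith
  have c1 : ContinuousAt (fun z : ℝ =>
      ∑ k ∈ Finset.range i, (-1) ^ k * z ^ (k + 1) * ((d k : ℝ) + 1)) β⁻¹ := by fun_prop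
  have c2 : ContinuousAt (fun z : ℝ => 1 + (1 - (-1) ^ i) / 2 * z ^ i
      + (1 - β * z) * (1 / (1 - z) * (i : ℝ))) β⁻¹ := by
    fun_prop (disch := assumption)
  have t1 := c1.tendsto.mono_left (nhdsWithin_le_nhds (s := Set.Iio β⁻¹))
  have t2 := c2.tendsto.mono_left (nhdsWithin_le_nhds (s := Set.Iio β⁻¹))
  have := le_of_tendsto_of_tendsto t1 t2 (by
    have hpos : ∀ᶠ z in 𝓝[<] β⁻¹, (0 : ℝ) < z :=
      nhdsWithin_le_nhds (lt_mem_nhds (by positivity))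
    filter_upwards [hpos, self_mem_nhdsWithin] with z hz hz1
    refine S_bound hd hβ hE i hz ?_
    have hz1 : z < β⁻¹ := hz1
    have := mul_lt_mul_of_pos_left hz1 hβ0
    rwa [mul_inv_cancel₀ hβ0.ne'] at this)
  simpa [hβ0.ne'] using this

theorem geo (z : ℝ) (i : ℕ) : (1 + z) * ∑ k ∈ Finset.range i, (-1 : ℝ) ^ k * z ^ (k + 1) =
    z * (1 - (-1) ^ i * z ^ i) := by
  induction i with
  | zero => simp
  | succ i ih => rw [Finset.sum_range_succ, mul_add, ih]; ring

end AltAux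


/-- Corollary 2: if `d_1 d_2 ⋯ d_{i−1} j ∈ L_M` with `(−1)^i (d_i − j) < 0`, then
`f_β(d_1 ⋯ d_{i−1} j) ≥ −β/(β+1)`.  Here `i ≥ 1` is the paper's 1-based index,
so the paper's `d_k` is `d (k-1)`. -/
theorem stmt14 (d : ℕ → ℕ) (hd : IsAltLyndon d) (β : ℝ)
    (hE : EntropyIs d (Real.log β)) (hpos : 0 < Real.log β)
    (i : ℕ) (hi : 1 ≤ i) (j : ℕ)
    (hw : ((List.range (i - 1)).map d ++ [j]) ∈ LyndonLang d)
    (hj : (-1 : ℤ) ^ i * ((d (i - 1) : ℤ) - (j : ℤ)) < 0) :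
    -β / (β + 1) ≤
      (∑ k ∈ Finset.range (i - 1), (d k : ℝ) / (-β) ^ (k + 1)) +
        (j : ℝ) / (-β) ^ i := by
  by_cases hβ : 1 < β
  · obtain ⟨m, rfl⟩ : ∃ m, i = m + 1 := ⟨i - 1, by omega⟩
    simp only [Nat.add_sub_cancel] at *
    have hS := AltAux.S_lim hd hβ hE (m + 1)
    have hβ0 : 0 < β := by linarith
    set z := β⁻¹ with hz
    have hz0 : 0 < z := by positivity
    have hbz : β * z = 1 := mul_inv_cancel₀ hβ0.ne'
    have hg := AltAux.geo z (m + 1)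
    have hdiv : ∀ (a : ℝ) (k : ℕ), a / (-β) ^ (k + 1) = -((-1) ^ k * z ^ (k + 1) * a) := by
      intro a k
      have hn : (-1 : ℝ) ^ k * (-1) ^ k = 1 := by rw [← mul_pow]; simp
      rw [div_eq_iff (by simp [hβ0.ne']), neg_pow β, pow_succ (-1 : ℝ)]
      have : z ^ (k + 1) * β ^ (k + 1) = 1 := by rw [← mul_pow, mul_comm z, hbz, one_pow]
      linear_combination (-a) * hn - a * ((-1) ^ k * (-1) ^ k) * this
    simp only [hdiv]
    rw [Finset.sum_neg_distrib]
    have hsplit : ∑ k ∈ Finset.range (m + 1), (-1) ^ k * z ^ (k + 1) * ((d k : ℝ) + 1) =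
        ∑ k ∈ Finset.range m, (-1) ^ k * z ^ (k + 1) * (d k : ℝ)
        + (-1) ^ m * z ^ (m + 1) * (d m : ℝ)
        + ∑ k ∈ Finset.range (m + 1), (-1) ^ k * z ^ (k + 1) := by
      rw [← Finset.sum_range_succ, ← Finset.sum_add_distrib]
      apply Finset.sum_congr rfl
      intro k _
      ring
    rw [hsplit] at hS
    have hj' : (-1 : ℝ) ^ (m + 1) * ((d m : ℝ) - j) ≤ -1 := by
      have : (-1 : ℤ) ^ (m + 1) * ((d m : ℤ) - j) ≤ -1 := by omega
      exact_mod_cast this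
    have hJ := mul_le_mul_of_nonneg_left hj' (pow_pos hz0 (m + 1)).le
    have hgz : ∑ k ∈ Finset.range (m + 1), (-1 : ℝ) ^ k * z ^ (k + 1) =
        z / (1 + z) * (1 - (-1) ^ (m + 1) * z ^ (m + 1)) := by
      field_simp
      linarith
    have hzz : z / (1 + z) = 1 / (β + 1) := by
      rw [div_eq_div_iff (by positivity) (by positivity)]
      linear_combination hbz
    have hbb : -β / (β + 1) = 1 / (β + 1) - 1 := by field_simp; ring
    rw [hgz, hzz] at hS
    rw [hbb]
    have hb1 : 0 < 1 / (β + 1) := by positivity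
    have hb2 : 1 / (β + 1) < 1 := by rw [div_lt_one (by positivity)]; linarith
    have hzp : 0 < z ^ (m + 1) := by positivity
    set b := 1 / (β + 1)
    set Z := z ^ (m + 1)
    have hp1 : 0 < b * Z := by positivity
    have hp2 : b * Z < Z := by nlinarith
    rw [pow_succ (-1 : ℝ)] at hS hJ
    rcases neg_one_pow_eq_or ℝ m with h | h <;> rw [h] at hS hJ ⊢ <;> nlinarith
  · have hneg : β < -1 := by
      by_contra hc
      have := Real.log_nonpos (abs_nonneg β) (abs_le.2 ⟨by linarith, by linarith⟩)
      rw [Real.log_abs] at this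
      linarith
    have h1 : -β / (β + 1) ≤ 0 := div_nonpos_of_nonneg_of_nonpos (by linarith) (by linarith)
    have hb : 0 < -β := by linarith
    refine h1.trans (add_nonneg (Finset.sum_nonneg fun k _ => ?_) ?_) <;> positivity
end
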